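/- arXiv:1811.12226 — 3 statements merged into one kernel-verified Lean document; each statement's English description precedes it below -/
import Mathlib

section
/- For every n ≥ 1, the group E₂(Γ_n(ℤ)) is a nontrivial free product with amalgamation; that is, there exist groups A, B, C, injective group homomorphisms f : C → A and g : C → B, neither of which is surjective, and a group isomorphism between E₂(Γ_n(ℤ)) and the amalgamated free product A ∗_C B (the pushout of f and g). -/
universe u v w

/-- A two-element family of types indexed by `Bool`. -/
def boolFam (A B : Type u) : Bool → Type u := fun b => match b with
  | true => A
  | false => B

instance boolFamGroup {A B : Type u} [Group A] [Group B] : ∀ b, Group (boolFam A B b)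
  | true => inferInstanceAs (Group A)
  | false => inferInstanceAs (Group B)

/-- The pair of maps `f : C →* A`, `g : C →* B` as a `Bool`-indexed family. -/
def boolHoms {A B C : Type u} [Group A] [Group B] [Group C] (f : C →* A) (g : C →* B) :
    (b : Bool) → C →* boolFam A B b
  | true => f
  | false => g

/-- A group `Γ` is a nontrivial free product with amalgamation if it is isomorphic to the
pushout (amalgamated free product) `A ∗_C B` of two injective, non-surjective group
homomorphisms `f : C → A` and `g : C → B`. -/
def IsNontrivialAmalgam (Γ : Type v) [Group Γ] : Prop :=
  ∃ (A B C : Type v) (_ : Group A) (_ : Group B) (_ : Group C)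
    (f : C →* A) (g : C →* B),
      Function.Injective f ∧ Function.Injective g ∧
      ¬ Function.Surjective f ∧ ¬ Function.Surjective g ∧
      Nonempty (Γ ≃* Monoid.PushoutI (boolHoms f g))

noncomputable section

open CliffordAlgebra

/-- The quadratic form `-(x₀² + ⋯ + x_{n-2}²)` on `ℤ^{n-1}`. -/
def Qf (n : ℕ) : QuadraticForm ℤ (Fin (n - 1) → ℤ) :=
  QuadraticMap.weightedSumSquares ℤ (fun _ : Fin (n - 1) => (-1 : ℤ))

/-- The Clifford algebra `C_n(ℤ)`. -/
abbrev Cl (n : ℕ) := CliffordAlgebra (Qf n)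

/-- The generator `i_h` of `C_n(ℤ)`. -/
def iGen (n : ℕ) (h : Fin (n - 1)) : Cl n := ι (Qf n) (Pi.single h 1)

/-- The submodule `Vⁿ(ℤ)` spanned by `1, i_1, …, i_{n-1}`. -/
def Vn (n : ℕ) : Submodule ℤ (Cl n) :=
  Submodule.span ℤ (insert 1 (Set.range (iGen n)))

/-- The elementary unit `E(x)`. -/
def Eu (n : ℕ) (x : Cl n) : (Matrix (Fin 2) (Fin 2) (Cl n))ˣ where
  val := !![x, 1; -1, 0]
  inv := !![0, -1; 1, x]
  val_inv := by
    ext i j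
    fin_cases i <;> fin_cases j <;>
      simp [Matrix.mul_apply, Fin.sum_univ_two, Matrix.one_apply]
  inv_val := by
    ext i j
    fin_cases i <;> fin_cases j <;>
      simp [Matrix.mul_apply, Fin.sum_univ_two, Matrix.one_apply]

/-- The group `E₂(Γ_n(ℤ))`. -/
def E2Gamma (n : ℕ) : Subgroup (Matrix (Fin 2) (Fin 2) (Cl n))ˣ :=
  Subgroup.closure {u | ∃ x ∈ Vn n, u = Eu n x}

lemma iGen_sq (n : ℕ) (h : Fin (n - 1)) : iGen n h * iGen n h = -1 := by
  rw [iGen, ι_sq_scalar]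
  have : Qf n (Pi.single h 1) = -1 := by
    simp [Qf, Pi.single_apply]
  rw [this]
  simp

/-- `i_h` as a unit of `C_n(ℤ)`. -/
def iUnit (n : ℕ) (h : Fin (n - 1)) : (Cl n)ˣ where
  val := iGen n h
  inv := -iGen n h
  val_inv := by rw [mul_neg, iGen_sq]; simp
  inv_val := by rw [neg_mul, iGen_sq]; simp

/-- The unit group `U_n` of `Γ_n(ℤ)`, generated by `-1` and the `i_h`. -/
def Un (n : ℕ) : Subgroup (Cl n)ˣ :=
  Subgroup.closure (insert (-1) (Set.range (iUnit n)))

section PingPong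

open Monoid Monoid.PushoutI

variable {Γ : Type v} [Group Γ]

/-- The inclusions of `A ⊓ B` into two subgroups `A` and `B`. -/
abbrev infHoms (A B : Subgroup Γ) : (b : Bool) → ↥(A ⊓ B) →* boolFam A B b :=
  boolHoms (Subgroup.inclusion inf_le_left) (Subgroup.inclusion inf_le_right)

/-- The inclusions of two subgroups into the ambient group, as a `Bool`-indexed family. -/
def boolSubtype (A B : Subgroup Γ) : (b : Bool) → boolFam A B b →* Γ
  | true => A.subtype
  | false => B.subtype

lemma boolSubtype_comp_infHoms (A B : Subgroup Γ) (b : Bool) :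
    (boolSubtype A B b).comp (infHoms A B b) = (A ⊓ B).subtype := by
  cases b <;> rfl

lemma infHoms_injective (A B : Subgroup Γ) (b : Bool) : Function.Injective (infHoms A B b) := by
  cases b
  · exact Subgroup.inclusion_injective (inf_le_right : A ⊓ B ≤ B)
  · exact Subgroup.inclusion_injective (inf_le_left : A ⊓ B ≤ A)

/-- The canonical map from the amalgam of two subgroups over their intersection. -/
def amalgamToGroup (A B : Subgroup Γ) : PushoutI (infHoms A B) →* Γ :=
  PushoutI.lift (boolSubtype A B) (A ⊓ B).subtype (boolSubtype_comp_infHoms A B)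

lemma amalgamToGroup_surjective {A B : Subgroup Γ} (hAB : A ⊔ B = ⊤) :
    Function.Surjective (amalgamToGroup A B) := by
  rw [← MonoidHom.range_eq_top, eq_top_iff, ← hAB, sup_le_iff]
  constructor
  · intro g hg
    exact ⟨of (φ := infHoms A B) true (⟨g, hg⟩ : A), PushoutI.lift_of _ _ _ _⟩
  · intro g hg
    exact ⟨of (φ := infHoms A B) false (⟨g, hg⟩ : B), PushoutI.lift_of _ _ _ _⟩

variable {X : Type w} [MulAction Γ X]

/-- Ping-pong criterion for the amalgam of two subgroups to embed. -/
lemma amalgamToGroup_injective {A B : Subgroup Γ} {e : X} {P N : Set X}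
    (heP : e ∉ P) (heN : e ∉ N)
    (hAe : ∀ a ∈ A, a ∉ B → ∀ b ∈ B, a • b • e ∈ P)
    (hAN : ∀ a ∈ A, a ∉ B → ∀ x ∈ N, a • x ∈ P)
    (hBP : ∀ b ∈ B, b ∉ A → ∀ x ∈ P, b • x ∈ N)
    (hCP : ∀ c ∈ A, c ∈ B → ∀ x ∈ P, c • x ∈ P)
    (hCN : ∀ c ∈ A, c ∈ B → ∀ x ∈ N, c • x ∈ N) :
    Function.Injective (amalgamToGroup A B) := by
  classical
  obtain ⟨d⟩ := NormalWord.transversal_nonempty (infHoms A B) (infHoms_injective A B)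
  have key : ∀ w : NormalWord d,
      (w.fstIdx = none ∧ ∃ c, w.prod = base (infHoms A B) c) ∨
      (w.fstIdx = some true ∧ amalgamToGroup A B w.prod • e ∈ P) ∨
      (w.fstIdx = some false ∧ (amalgamToGroup A B w.prod • e ∈ N ∨
        (amalgamToGroup A B w.prod ∈ B ∧ amalgamToGroup A B w.prod ∉ A))) := by
    intro w
    induction w using NormalWord.consRecOn with
    | empty => exact Or.inl ⟨rfl, 1, by simp⟩
    | cons i g w hmw _ hgr _ ih =>
      have hfst : (NormalWord.cons g w hmw hgr).fstIdx = some i := by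
        simp [NormalWord.cons, CoprodI.Word.fstIdx, CoprodI.Word.cons]
      have hprod : amalgamToGroup A B (NormalWord.cons g w hmw hgr).prod =
          boolSubtype A B i g * amalgamToGroup A B w.prod := by
        rw [NormalWord.prod_cons, map_mul]
        rfl
      have hbase : ∀ c, amalgamToGroup A B (base (infHoms A B) c) = c := fun c =>
        PushoutI.lift_base _ _ _ _
      rw [hfst, hprod]
      cases i with
      | true =>
        obtain ⟨a, ha⟩ : A := g
        have haB : a ∉ B := fun h => hgr ⟨⟨a, ha, h⟩, rfl⟩
        change (_ ∨ (_ ∧ (a * _) • e ∈ P) ∨ _)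
        refine Or.inr (Or.inl ⟨rfl, ?_⟩)
        rw [mul_smul]
        rcases ih with ⟨-, c, hc⟩ | ⟨h, -⟩ | ⟨-, h | h⟩
        · rw [hc, hbase]
          exact hAe a ha haB _ c.2.2
        · exact absurd h hmw
        · exact hAN a ha haB _ h
        · exact hAe a ha haB _ h.1
      | false =>
        obtain ⟨b, hb⟩ : B := g
        have hbA : b ∉ A := fun h => hgr ⟨⟨b, h, hb⟩, rfl⟩
        change (_ ∨ _ ∨ (_ ∧ ((b * _) • e ∈ N ∨ (b * _ ∈ B ∧ b * _ ∉ A))))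
        refine Or.inr (Or.inr ⟨rfl, ?_⟩)
        rcases ih with ⟨-, c, hc⟩ | ⟨-, h⟩ | ⟨h, -⟩
        · rw [hc, hbase]
          exact Or.inr ⟨B.mul_mem hb c.2.2, fun h => hbA ((A.mul_mem_cancel_right c.2.1).1 h)⟩
        · rw [mul_smul]
          exact Or.inl (hBP b hb hbA _ h)
        · exact absurd h hmw
    | base c w _ ih =>
      have hfst : (base (infHoms A B) c • w).fstIdx = w.fstIdx := by
        rw [NormalWord.base_smul_def]
      have hprod : amalgamToGroup A B (base (infHoms A B) c • w).prod =
          c * amalgamToGroup A B w.prod := by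
        rw [NormalWord.prod_smul, map_mul]
        exact congrArg (· * _) (PushoutI.lift_base _ _ _ _)
      rw [hfst, hprod, mul_smul]
      rcases ih with ⟨h, c', hc⟩ | ⟨h, h'⟩ | ⟨h, h'⟩
      · exact Or.inl ⟨h, c * c', by rw [NormalWord.prod_smul, hc, map_mul]⟩
      · exact Or.inr (Or.inl ⟨h, hCP _ c.2.1 c.2.2 _ h'⟩)
      · refine Or.inr (Or.inr ⟨h, h'.imp (hCN _ c.2.1 c.2.2 _) fun h' => ?_⟩)
        exact ⟨B.mul_mem c.2.2 h'.1, fun h => h'.2 ((A.mul_mem_cancel_left c.2.1).1 h)⟩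
  rw [injective_iff_map_eq_one]
  intro x hx
  have hw : (x • (NormalWord.empty : NormalWord d)).prod = x := by simp
  have := key (x • NormalWord.empty)
  rw [hw, hx, one_smul] at this
  rcases this with ⟨-, c, hc⟩ | ⟨-, h⟩ | ⟨-, h | h⟩
  · have : amalgamToGroup A B x = c := by
      rw [hc]
      exact PushoutI.lift_base _ _ _ _
    rw [hc, Subtype.ext (this.symm.trans hx : (c : Γ) = (1 : ↥(A ⊓ B))), map_one]
  · exact absurd h heP
  · exact absurd h heN
  · exact absurd A.one_mem h.2

/-- A group generated by two subgroups playing ping-pong relative to their intersection is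
their amalgam. -/
theorem isNontrivialAmalgam_of_pingPong {A B : Subgroup Γ} (hAB : A ⊔ B = ⊤)
    (hA : ¬ A ≤ B) (hB : ¬ B ≤ A) {e : X} {P N : Set X}
    (heP : e ∉ P) (heN : e ∉ N)
    (hAe : ∀ a ∈ A, a ∉ B → ∀ b ∈ B, a • b • e ∈ P)
    (hAN : ∀ a ∈ A, a ∉ B → ∀ x ∈ N, a • x ∈ P)
    (hBP : ∀ b ∈ B, b ∉ A → ∀ x ∈ P, b • x ∈ N)
    (hCP : ∀ c ∈ A, c ∈ B → ∀ x ∈ P, c • x ∈ P)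
    (hCN : ∀ c ∈ A, c ∈ B → ∀ x ∈ N, c • x ∈ N) :
    IsNontrivialAmalgam Γ := by
  refine ⟨A, B, ↥(A ⊓ B), inferInstance, inferInstance, inferInstance,
    Subgroup.inclusion inf_le_left, Subgroup.inclusion inf_le_right,
    Subgroup.inclusion_injective _, Subgroup.inclusion_injective _, ?_, ?_,
    ⟨(MulEquiv.ofBijective (amalgamToGroup A B)
      ⟨amalgamToGroup_injective heP heN hAe hAN hBP hCP hCN,
        amalgamToGroup_surjective hAB⟩).symm⟩⟩
  · intro h
    refine hA fun a ha => ?_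
    obtain ⟨c, hc⟩ := h ⟨a, ha⟩
    have : (c : Γ) = a := congrArg Subtype.val hc
    exact this ▸ c.2.2
  · intro h
    refine hB fun b hb => ?_
    obtain ⟨c, hc⟩ := h ⟨b, hb⟩
    have : (c : Γ) = b := congrArg Subtype.val hc
    exact this ▸ c.2.1

end PingPong
section LorentzLattice

/-- Integral Hermitian `2 × 2` matrices `!![p, x; star x, q]` with `p q : ℤ` and `x ∈ Vⁿ(ℤ)`; the
off-diagonal entry `x` has coordinates `x0` (real part) and `x` (coefficients of the `i_h`). -/
@[ext]
structure Herm (n : ℕ) where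
  p : ℤ
  q : ℤ
  x0 : ℤ
  x : Fin (n - 1) → ℤ

namespace Herm

variable {n : ℕ}

instance : Neg (Herm n) := ⟨fun v => ⟨-v.p, -v.q, -v.x0, -v.x⟩⟩

@[simp] lemma neg_p (v : Herm n) : (-v).p = -v.p := rfl
@[simp] lemma neg_q (v : Herm n) : (-v).q = -v.q := rfl
@[simp] lemma neg_x0 (v : Herm n) : (-v).x0 = -v.x0 := rfl
@[simp] lemma neg_x (v : Herm n) : (-v).x = -v.x := rfl

instance : InvolutiveNeg (Herm n) where
  neg_neg v := by ext <;> simp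

/-- Twice the polarisation of the Lorentzian quadratic form `|x|² - p q`. -/
def form (v w : Herm n) : ℤ :=
  2 * (v.x0 * w.x0) + 2 * (v.x ⬝ᵥ w.x) - v.p * w.q - v.q * w.p

/-- The unit spacelike vector `1 ∈ Vⁿ(ℤ)`. -/
def e0 : Herm n := ⟨0, 0, 1, 0⟩

/-- The identity matrix, a timelike vector orthogonal to `e0`. -/
def z0 : Herm n := ⟨1, 1, 0, 0⟩

/-- Unit spacelike vectors congruent to `e0` modulo `2` in the coordinates `p`, `q`, `x0`. -/
def IsRoot (v : Herm n) : Prop := form v v = 2 ∧ Even v.p ∧ Even v.q ∧ Odd v.x0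

/-- The open positive cone. -/
def IsPos (v : Herm n) : Prop := 0 < v.p ∧ form v v < 0

/-- The vector `v` is positive on the point `!![2, 1; 1, 2]`. -/
def Up (v : Herm n) : Prop := v.p + v.q < v.x0

lemma form_comm (v w : Herm n) : form v w = form w v := by
  simp only [form, dotProduct_comm v.x w.x]
  ring

lemma form_e0 (v : Herm n) : form v e0 = 2 * v.x0 := by simp [form, e0]

lemma form_z0 (v : Herm n) : form z0 v = -(v.p + v.q) := by
  simp [form, z0]
  ring

lemma form_z0_e0 : form (z0 : Herm n) e0 = 0 := by simp [form, e0, z0]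

lemma isRoot_e0 : IsRoot (e0 : Herm n) := by simp [IsRoot, form, e0]

lemma isPos_z0 : IsPos (z0 : Herm n) := by simp [IsPos, form, z0]

lemma up_e0 : Up (e0 : Herm n) := by simp [Up, e0]

lemma not_up_neg_e0 : ¬ Up (-e0 : Herm n) := by simp [Up, e0]

lemma IsRoot.neg {v : Herm n} (hv : IsRoot v) : IsRoot (-v) := by
  obtain ⟨h, hp, hq, hx⟩ := hv
  refine ⟨?_, hp.neg, hq.neg, hx.neg⟩
  simpa [form] using h

lemma dotProduct_self_nonneg_int {ι : Type*} [Fintype ι] (x : ι → ℤ) : 0 ≤ x ⬝ᵥ x :=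
  Finset.sum_nonneg fun i _ => mul_self_nonneg (x i)

lemma dotProduct_sq_le {ι : Type*} [Fintype ι] (x y : ι → ℤ) :
    (x ⬝ᵥ y) ^ 2 ≤ (x ⬝ᵥ x) * (y ⬝ᵥ y) := by
  have := Finset.sum_mul_sq_le_sq_mul_sq Finset.univ x y
  simpa only [dotProduct, ← sq] using this

/-- Reversed Cauchy–Schwarz inequality on the closed positive cone. -/
lemma dotProduct_le_of_cone {ι : Type*} [Fintype ι] {x y : ι → ℤ} {p q r s : ℤ}
    (h : x ⬝ᵥ x ≤ p * q) (hpq : 0 < p + q) (h' : y ⬝ᵥ y ≤ r * s) (hrs : 0 < r + s) :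
    2 * (x ⬝ᵥ y) ≤ p * s + q * r := by
  have hx := dotProduct_self_nonneg_int x
  have hy := dotProduct_self_nonneg_int y
  have hp : 0 ≤ p := by nlinarith
  have hq : 0 ≤ q := by nlinarith
  have hr : 0 ≤ r := by nlinarith
  have hs : 0 ≤ s := by nlinarith
  refine (le_abs_self _).trans (abs_le_of_sq_le_sq ?_ (by positivity))
  nlinarith [dotProduct_sq_le x y, mul_le_mul h h' hy (hx.trans h), sq_nonneg (p * s - q * r)]

/-- Strict reversed Cauchy–Schwarz inequality on the positive cone. -/
lemma dotProduct_lt_of_cone {ι : Type*} [Fintype ι] {x y : ι → ℤ} {p q r s : ℤ}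
    (h : x ⬝ᵥ x < p * q) (hpq : 0 < p + q) (h' : y ⬝ᵥ y ≤ r * s) (hrs : 0 < r + s) :
    2 * (x ⬝ᵥ y) < p * s + q * r := by
  have hx := dotProduct_self_nonneg_int x
  have hy := dotProduct_self_nonneg_int y
  have hp : 0 < p := by nlinarith
  have hq : 0 < q := by nlinarith
  have hr : 0 ≤ r := by nlinarith
  have hs : 0 ≤ s := by nlinarith
  have hS : 0 < p * s + q * r := by
    rcases hr.eq_or_lt with rfl | hr
    · have : 0 < s := by linarith
      positivity
    · positivity
  refine (le_abs_self _).trans_lt (abs_lt_of_sq_lt_sq ?_ hS.le)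
  rcases (hy.trans h').eq_or_lt with h0 | h0
  · have : y ⬝ᵥ y = 0 := by linarith
    have := dotProduct_sq_le x y
    nlinarith
  · nlinarith [dotProduct_sq_le x y, mul_lt_mul_of_pos_right h h0,
      mul_le_mul_of_nonneg_left h' hx, sq_nonneg (p * s - q * r)]

lemma IsRoot.x0_ne_zero {v : Herm n} (hv : IsRoot v) : v.x0 ≠ 0 := by
  intro h
  simpa [h] using hv.2.2.2

lemma IsRoot.one_add_mul {v : Herm n} (hv : IsRoot v) :
    1 + v.p * v.q = v.x0 ^ 2 + v.x ⬝ᵥ v.x := by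
  have := hv.1
  simp only [form] at this
  linarith

lemma IsRoot.one_le_sq {v : Herm n} (hv : IsRoot v) : 1 ≤ v.x0 ^ 2 := by
  have := sq_pos_of_ne_zero hv.x0_ne_zero
  omega

lemma IsRoot.dotProduct_le {v : Herm n} (hv : IsRoot v) : v.x ⬝ᵥ v.x ≤ v.p * v.q := by
  linarith [hv.one_add_mul, hv.one_le_sq]

lemma IsRoot.eq_of_add_eq_zero {v : Herm n} (hv : IsRoot v) (h : v.p + v.q = 0) :
    v = e0 ∨ v = -e0 := by
  have h1 := hv.one_add_mul
  have h2 := hv.one_le_sq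
  have hx := dotProduct_self_nonneg_int v.x
  have hq : v.q = -v.p := by linarith
  rw [hq] at h1
  have hp : v.p = 0 := by nlinarith [sq_nonneg v.p]
  have hx' : v.x = 0 := dotProduct_self_eq_zero.1 (by nlinarith [sq_nonneg v.p])
  have hx0 : v.x0 ^ 2 = 1 := by nlinarith [sq_nonneg v.p]
  rcases Int.isUnit_iff.1 (IsUnit.of_mul_eq_one _ ((sq v.x0).symm.trans hx0)) with h0 | h0
  · left
    ext <;> simp [e0, *]
  · right
    ext <;> simp [e0, *]

lemma IsRoot.sq_lt {v : Herm n} (hv : IsRoot v) (h : v.p + v.q ≠ 0) :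
    v.x0 ^ 2 < (v.p + v.q) ^ 2 := by
  have h1 := hv.one_add_mul
  have hx := dotProduct_self_nonneg_int v.x
  obtain ⟨-, hp, hq, -⟩ := hv
  obtain ⟨c, hc⟩ := hp.add hq
  have h2 : 1 ≤ c ^ 2 := Int.add_one_le_iff.2 (sq_pos_of_ne_zero (by rintro rfl; simp [hc] at h))
  have h3 : (v.p + v.q) ^ 2 = 4 * c ^ 2 := by
    rw [hc]
    ring
  nlinarith [sq_nonneg (v.p - v.q)]

lemma IsRoot.up_iff {v : Herm n} (hv : IsRoot v) : Up v ↔ v = e0 ∨ v.p + v.q < 0 := by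
  rcases lt_trichotomy (v.p + v.q) 0 with h | h | h
  · refine iff_of_true ?_ (Or.inr h)
    have h1 := sq_lt_sq.1 (hv.sq_lt h.ne)
    have h2 := neg_abs_le v.x0
    rw [abs_of_neg h] at h1
    simp only [Up]
    linarith
  · rcases hv.eq_of_add_eq_zero h with rfl | rfl
    · simp [up_e0]
    · simp [e0, Up, Herm.ext_iff]
  · refine iff_of_false ?_ ?_
    · have h1 := sq_lt_sq.1 (hv.sq_lt h.ne')
      have h2 := le_abs_self v.x0
      rw [abs_of_pos h] at h1
      simp only [Up]
      linarith
    · rintro (rfl | h')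
      · simp [e0] at h
      · linarith

lemma IsPos.add_pos {v : Herm n} (hv : IsPos v) : 0 < v.p + v.q := by
  obtain ⟨h, h'⟩ := hv
  simp only [form] at h'
  have := dotProduct_self_nonneg_int v.x
  have : 0 < v.q := by nlinarith [mul_self_nonneg v.x0]
  linarith

lemma IsPos.dotProduct_lt {v : Herm n} (hv : IsPos v) : v.x ⬝ᵥ v.x < v.p * v.q := by
  have := hv.2
  simp only [form] at this
  nlinarith [mul_self_nonneg v.x0]

lemma IsPos.form_lt {u v : Herm n} (hu : IsPos u) (hv : IsRoot v) (h : 0 < v.p + v.q) :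
    form u v < 2 * (u.x0 * v.x0) := by
  have := dotProduct_lt_of_cone hu.dotProduct_lt hu.add_pos hv.dotProduct_le h
  simp only [form]
  linarith

lemma IsPos.lt_form {u v : Herm n} (hu : IsPos u) (hv : IsRoot v) (h : v.p + v.q < 0) :
    2 * (u.x0 * v.x0) < form u v := by
  have := hu.form_lt hv.neg (by simp; linarith)
  simp only [form, neg_p, neg_q, neg_x0, neg_x, dotProduct_neg] at this ⊢
  linarith

lemma IsRoot.form_le {v w : Herm n} (hv : IsRoot v) (hv' : v.p + v.q < 0) (hw : IsRoot w)
    (hw' : w.p + w.q < 0) : form v w ≤ 2 * (v.x0 * w.x0) := by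
  have := dotProduct_le_of_cone hv.neg.dotProduct_le (by simp; linarith) hw.neg.dotProduct_le
    (by simp; linarith)
  simp only [neg_p, neg_q, neg_x, dotProduct_neg, neg_dotProduct, neg_neg, neg_mul_neg] at this
  simp only [form]
  linarith

variable (n) in
/-- Permutations of `Herm n` preserving the Lorentzian form, negation, the positive cone and the
set of roots. -/
def isometries : Subgroup (Equiv.Perm (Herm n)) where
  carrier := {f | (∀ v w, form (f v) (f w) = form v w) ∧ (∀ v, f (-v) = -f v) ∧
    (∀ v, IsPos (f v) ↔ IsPos v) ∧ ∀ v, IsRoot (f v) ↔ IsRoot v}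
  one_mem' := by simp
  mul_mem' := by
    rintro f g ⟨h1, h2, h3, h4⟩ ⟨h1', h2', h3', h4'⟩
    exact ⟨by simp [h1, h1'], by simp [h2, h2'], by simp [h3, h3'], by simp [h4, h4']⟩
  inv_mem' := by
    rintro f ⟨h1, h2, h3, h4⟩
    refine ⟨fun v w => ?_, fun v => ?_, fun v => ?_, fun v => ?_⟩
    · rw [← h1]
      simp
    · rw [Equiv.Perm.inv_eq_iff_eq, h2]
      simp
    · rw [← h3]
      simp
    · rw [← h4]
      simp

variable {f : Equiv.Perm (Herm n)}

lemma form_apply_left (hf : f ∈ isometries n) (v w : Herm n) :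
    form (f v) w = form v (f⁻¹ w) := by
  rw [← hf.1 v]
  simp

lemma form_apply_right (hf : f ∈ isometries n) (v w : Herm n) :
    form v (f w) = form (f⁻¹ v) w := by
  rw [form_comm, form_apply_left hf, form_comm]

lemma inv_apply_e0_or (hf : f ∈ isometries n) (he : f e0 = e0 ∨ f e0 = -e0) :
    f⁻¹ e0 = e0 ∨ f⁻¹ e0 = -e0 := by
  simp only [Equiv.Perm.inv_eq_iff_eq, hf.2.1]
  rcases he with h | h
  · exact Or.inl h.symm
  · exact Or.inr (by rw [h, neg_neg])

lemma inv_z0_x0 (hf : f ∈ isometries n) (he : f e0 = e0 ∨ f e0 = -e0) :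
    (f⁻¹ z0).x0 = 0 := by
  have h : form (f⁻¹ z0) e0 = 0 := by
    rw [← form_apply_right hf]
    rcases he with h | h <;> rw [h] <;> simp [form, e0, z0]
  rw [form_e0] at h
  linarith

lemma add_pos_of_apply_e0 (hf : f ∈ isometries n) (he : f e0 = e0 ∨ f e0 = -e0) {v : Herm n}
    (hv : IsRoot v) (h : 0 < v.p + v.q) : 0 < (f v).p + (f v).q := by
  have hu : IsPos (f⁻¹ z0) := ((inv_mem hf).2.2.1 _).2 isPos_z0
  have := hu.form_lt hv h
  rw [inv_z0_x0 hf he, ← form_apply_right hf, form_z0] at this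
  linarith

lemma add_neg_of_apply_e0 (hf : f ∈ isometries n) (he : f e0 = e0 ∨ f e0 = -e0) {v : Herm n}
    (hv : IsRoot v) (h : v.p + v.q < 0) : (f v).p + (f v).q < 0 := by
  have := add_pos_of_apply_e0 hf he hv.neg (by simp; linarith)
  rw [hf.2.1] at this
  simp at this
  linarith

lemma apply_x0_of_apply_e0 (hf : f ∈ isometries n) (he : f e0 = e0) (v : Herm n) :
    (f v).x0 = v.x0 := by
  have := hf.1 v e0
  rw [he, form_e0, form_e0] at this
  linarith

lemma apply_x0_of_apply_e0_neg (hf : f ∈ isometries n) (he : f e0 = -e0) (v : Herm n) :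
    (f v).x0 = -v.x0 := by
  have := hf.1 (-v) e0
  rw [he, hf.2.1, form_e0] at this
  simp [form, e0] at this
  linarith

/-- The roots whose wall lies on the positive side of the wall of `e0`. -/
def posSide : Set (Herm n) := {v | IsRoot v ∧ 0 < v.x0 * (v.p + v.q)}

/-- The roots whose wall lies on the negative side of the wall of `e0`. -/
def negSide : Set (Herm n) := {v | IsRoot v ∧ v.x0 * (v.p + v.q) < 0}

variable (n) in
/-- The stabiliser of the region containing `!![2, 1; 1, 2]`, among the regions cut out by the
walls of all roots. -/
def regionStab : Subgroup (Equiv.Perm (Herm n)) where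
  carrier := {f | f ∈ isometries n ∧ ∀ v, IsRoot v → (Up (f v) ↔ Up v)}
  one_mem' := by simp [one_mem]
  mul_mem' := by
    rintro f g ⟨hf, hf'⟩ ⟨hg, hg'⟩
    refine ⟨mul_mem hf hg, fun v hv => ?_⟩
    rw [Equiv.Perm.mul_apply, hf' _ ((hg.2.2.2 v).2 hv), hg' v hv]
  inv_mem' := by
    rintro f ⟨hf, hf'⟩
    refine ⟨inv_mem hf, fun v hv => ?_⟩
    rw [← hf' _ (((inv_mem hf).2.2.2 v).2 hv)]
    simp

variable (n) in
/-- The stabiliser of the wall of `e0`. -/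
def wallStab : Subgroup (Equiv.Perm (Herm n)) where
  carrier := {f | f ∈ isometries n ∧ (f e0 = e0 ∨ f e0 = -e0)}
  one_mem' := by simp [one_mem]
  mul_mem' := by
    rintro f g ⟨hf, hf'⟩ ⟨hg, hg'⟩
    refine ⟨mul_mem hf hg, ?_⟩
    rw [Equiv.Perm.mul_apply]
    rcases hg' with h | h <;> rcases hf' with h' | h' <;> simp [h, h', hf.2.1]
  inv_mem' := fun hf => ⟨inv_mem hf.1, inv_apply_e0_or hf.1 hf.2⟩

lemma mem_regionStab_of_apply_e0 (hf : f ∈ isometries n) (he : f e0 = e0) :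
    f ∈ regionStab n := by
  refine ⟨hf, fun v hv => ?_⟩
  rw [hv.up_iff, ((hf.2.2.2 v).2 hv).up_iff]
  refine or_congr (by rw [← f.injective.eq_iff (a := v), he]) ⟨fun h => ?_, fun h => ?_⟩
  · have he' : f⁻¹ e0 = e0 := by rw [Equiv.Perm.inv_eq_iff_eq, he]
    simpa using add_neg_of_apply_e0 (inv_mem hf) (Or.inl he') ((hf.2.2.2 v).2 hv) h
  · exact add_neg_of_apply_e0 hf (Or.inl he) hv h

lemma apply_e0_of_mem_of_mem (hA : f ∈ regionStab n) (hB : f ∈ wallStab n) : f e0 = e0 := by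
  refine hB.2.resolve_right fun h => not_up_neg_e0 (n := n) ?_
  rw [← h, hA.2 _ isRoot_e0]
  exact up_e0

lemma apply_e0_of_mem_of_notMem (hB : f ∈ wallStab n) (hA : f ∉ regionStab n) : f e0 = -e0 :=
  hB.2.resolve_left fun h => hA (mem_regionStab_of_apply_e0 hB.1 h)

lemma apply_e0_add_neg (hA : f ∈ regionStab n) (hB : f ∉ wallStab n) :
    (f e0).p + (f e0).q < 0 := by
  have hv : IsRoot (f e0) := (hA.1.2.2.2 _).2 isRoot_e0
  exact (hv.up_iff.1 ((hA.2 _ isRoot_e0).2 up_e0)).resolve_left fun h => hB ⟨hA.1, Or.inl h⟩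

lemma apply_e0_x0_neg (hA : f ∈ regionStab n) (hB : f ∉ wallStab n) : (f e0).x0 < 0 := by
  have hv : IsRoot (f e0) := (hA.1.2.2.2 _).2 isRoot_e0
  by_contra! hx
  have hy : IsPos (f z0) := (hA.1.2.2.1 _).2 isPos_z0
  have hy0 : 0 < (f z0).x0 := by
    have := apply_e0_add_neg (inv_mem hA) (fun h => hB (by simpa using inv_mem h))
    have h2 := form_apply_left hA.1 z0 e0
    rw [form_e0, form_z0] at h2
    linarith
  have := hy.lt_form hv (apply_e0_add_neg hA hB)
  rw [hA.1.1, form_z0_e0] at this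
  nlinarith [mul_nonneg hy0.le hx]

lemma neg_mem_posSide {v : Herm n} (hv : v ∈ posSide) : -v ∈ posSide :=
  ⟨hv.1.neg, by
    have := hv.2
    simp only [neg_p, neg_q, neg_x0]
    linarith⟩

lemma apply_mem_posSide_of_add_neg (hA : f ∈ regionStab n) (hB : f ∉ wallStab n) {w : Herm n}
    (hw : IsRoot w) (hw0 : 0 < w.x0) (h : w.p + w.q < 0) : f w ∈ posSide := by
  have hA' := inv_mem hA
  have hB' : f⁻¹ ∉ wallStab n := fun h => hB (by simpa using inv_mem h)
  have hfw : IsRoot (f w) := (hA.1.2.2.2 _).2 hw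
  have hx : (f w).x0 < 0 := by
    have h1 := form_apply_left hA.1 w e0
    have h2 := hw.form_le h ((hA'.1.2.2.2 _).2 isRoot_e0) (apply_e0_add_neg hA' hB')
    have h3 := mul_neg_of_pos_of_neg hw0 (apply_e0_x0_neg hA' hB')
    rw [form_e0] at h1
    linarith
  refine ⟨hfw, mul_pos_of_neg_of_neg hx ?_⟩
  refine (hfw.up_iff.1 ((hA.2 _ hw).2 (hw.up_iff.2 (Or.inr h)))).resolve_left fun h => ?_
  rw [h] at hx
  simp [e0] at hx

lemma apply_mem_posSide (hA : f ∈ regionStab n) (hB : f ∉ wallStab n) {w : Herm n}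
    (hw : w ∈ negSide) : f w ∈ posSide := by
  obtain ⟨hw, h⟩ := hw
  rcases mul_neg_iff.1 h with ⟨h1, h2⟩ | ⟨h1, h2⟩
  · exact apply_mem_posSide_of_add_neg hA hB hw h1 h2
  · have := neg_mem_posSide (apply_mem_posSide_of_add_neg hA hB hw.neg (by simpa using h1)
      (by simp; linarith))
    rwa [hA.1.2.1, neg_neg] at this

lemma apply_apply_e0_mem_posSide (hA : f ∈ regionStab n) (hB : f ∉ wallStab n)
    {g : Equiv.Perm (Herm n)} (hg : g ∈ wallStab n) : f (g e0) ∈ posSide := by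
  have h : f e0 ∈ posSide := ⟨(hA.1.2.2.2 _).2 isRoot_e0,
    mul_pos_of_neg_of_neg (apply_e0_x0_neg hA hB) (apply_e0_add_neg hA hB)⟩
  rcases hg.2 with h' | h' <;> rw [h']
  · exact h
  · rw [hA.1.2.1]
    exact neg_mem_posSide h

lemma mul_add_pos_of_apply_e0 (hf : f ∈ isometries n) (he : f e0 = e0 ∨ f e0 = -e0)
    {v : Herm n} (hv : IsRoot v) {a : ℤ} (h : 0 < a * (v.p + v.q)) :
    0 < a * ((f v).p + (f v).q) := by
  rcases mul_pos_iff.1 h with ⟨h1, h2⟩ | ⟨h1, h2⟩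
  · exact mul_pos h1 (add_pos_of_apply_e0 hf he hv h2)
  · exact mul_pos_of_neg_of_neg h1 (add_neg_of_apply_e0 hf he hv h2)

lemma apply_mem_negSide (hB : f ∈ wallStab n) (hA : f ∉ regionStab n) {v : Herm n}
    (hv : v ∈ posSide) : f v ∈ negSide := by
  refine ⟨(hB.1.2.2.2 _).2 hv.1, ?_⟩
  rw [apply_x0_of_apply_e0_neg hB.1 (apply_e0_of_mem_of_notMem hB hA)]
  linarith [mul_add_pos_of_apply_e0 hB.1 hB.2 hv.1 hv.2]

lemma apply_mem_posSide_of_mem_of_mem (hA : f ∈ regionStab n) (hB : f ∈ wallStab n) {v : Herm n}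
    (hv : v ∈ posSide) : f v ∈ posSide := by
  refine ⟨(hB.1.2.2.2 _).2 hv.1, ?_⟩
  rw [apply_x0_of_apply_e0 hB.1 (apply_e0_of_mem_of_mem hA hB)]
  exact mul_add_pos_of_apply_e0 hB.1 hB.2 hv.1 hv.2

lemma apply_mem_negSide_of_mem_of_mem (hA : f ∈ regionStab n) (hB : f ∈ wallStab n) {v : Herm n}
    (hv : v ∈ negSide) : f v ∈ negSide := by
  refine ⟨(hB.1.2.2.2 _).2 hv.1, ?_⟩
  rw [apply_x0_of_apply_e0 hB.1 (apply_e0_of_mem_of_mem hA hB)]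
  have := mul_add_pos_of_apply_e0 hB.1 hB.2 hv.1 (a := -v.x0) (by linarith [hv.2])
  linarith

end Herm

end LorentzLattice
section Action

open Matrix

variable {n : ℕ}

/-- The element of `Vⁿ(ℤ)` with real part `a` and vector part `t`. -/
def paravec (n : ℕ) (a : ℤ) (t : Fin (n - 1) → ℤ) : Cl n := a • 1 + ι (Qf n) t

lemma star_paravec (a : ℤ) (t : Fin (n - 1) → ℤ) :
    star (paravec n a t) = a • 1 - ι (Qf n) t := by
  rw [paravec, star_add, CliffordAlgebra.star_smul, star_one, star_ι, sub_eq_add_neg]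

lemma exists_paravec_of_mem_Vn {x : Cl n} (hx : x ∈ Vn n) : ∃ a t, x = paravec n a t := by
  induction hx using Submodule.span_induction with
  | mem x hx =>
    rcases hx with rfl | ⟨h, rfl⟩
    · exact ⟨1, 0, by simp [paravec]⟩
    · exact ⟨0, Pi.single h 1, by simp [paravec, iGen]⟩
  | zero => exact ⟨0, 0, by simp [paravec]⟩
  | add x y _ _ hx hy =>
    obtain ⟨a, t, rfl⟩ := hx
    obtain ⟨b, s, rfl⟩ := hy
    refine ⟨a + b, t + s, ?_⟩
    simp only [paravec, map_add]
    module
  | smul c x _ hx =>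
    obtain ⟨a, t, rfl⟩ := hx
    refine ⟨c * a, c • t, ?_⟩
    simp only [paravec, map_smul]
    module

lemma paravec_mem_Vn (a : ℤ) (t : Fin (n - 1) → ℤ) : paravec n a t ∈ Vn n := by
  refine add_mem (Submodule.smul_mem _ _ (Submodule.subset_span (Or.inl rfl))) ?_
  rw [← Finset.univ_sum_single t, map_sum]
  refine Submodule.sum_mem _ fun h _ => ?_
  have : (Pi.single h (t h) : Fin (n - 1) → ℤ) = t h • Pi.single h 1 := by
    rw [← Pi.single_smul, smul_eq_mul, mul_one]
  rw [this, map_smul]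
  exact Submodule.smul_mem _ _ (Submodule.subset_span (Or.inr ⟨h, rfl⟩))

lemma Qf_apply (t : Fin (n - 1) → ℤ) : Qf n t = -(t ⬝ᵥ t) := by
  simp [Qf, QuadraticMap.weightedSumSquares_apply, dotProduct]

lemma ι_Qf_mul_self (t : Fin (n - 1) → ℤ) :
    ι (Qf n) t * ι (Qf n) t = (-(t ⬝ᵥ t)) • (1 : Cl n) := by
  rw [ι_sq_scalar, Qf_apply, Algebra.algebraMap_eq_smul_one]

lemma ι_Qf_mul_swap (s t : Fin (n - 1) → ℤ) :
    ι (Qf n) s * ι (Qf n) t = (-(2 * (s ⬝ᵥ t))) • (1 : Cl n) - ι (Qf n) t * ι (Qf n) s := by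
  rw [eq_sub_iff_add_eq, ι_mul_ι_add_swap, Algebra.algebraMap_eq_smul_one, QuadraticMap.polar,
    Qf_apply, Qf_apply, Qf_apply, dotProduct_add, add_dotProduct, add_dotProduct,
    dotProduct_comm t s]
  congr 1
  ring

lemma paravec_injective {a b : ℤ} {s t : Fin (n - 1) → ℤ}
    (h : paravec n a s = paravec n b t) : a = b ∧ s = t := by
  have hB : LinearMap.BilinMap.toQuadraticMap
      (dotProductBilin ℤ ℤ : LinearMap.BilinForm ℤ (Fin (n - 1) → ℤ)) = 0 - Qf n := by
    ext t
    simp [Qf_apply]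
  have := congrArg (changeForm hB) h
  simp only [paravec, map_add, map_smul, changeForm_one, changeForm_ι] at this
  have h2 : ExteriorAlgebra.ι ℤ (s - t) = algebraMap ℤ _ (b - a) := by
    rw [Algebra.algebraMap_eq_smul_one, map_sub, sub_smul, sub_eq_sub_iff_add_eq_add, add_comm]
    exact this.trans (add_comm _ _) |>.trans (add_comm _ _)
  obtain ⟨h3, h4⟩ := (ExteriorAlgebra.ι_eq_algebraMap_iff _ _).1 h2
  exact ⟨by linarith, sub_eq_zero.1 h3⟩

namespace Herm

/-- The Hermitian matrix over `C_n(ℤ)` described by an element of `Herm n`. -/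
def toMat (v : Herm n) : Matrix (Fin 2) (Fin 2) (Cl n) :=
  !![v.p • 1, paravec n v.x0 v.x; star (paravec n v.x0 v.x), v.q • 1]

lemma toMat_injective : Function.Injective (toMat : Herm n → _) := by
  intro v w h
  have h00 := congrFun (congrFun h 0) 0
  have h01 := congrFun (congrFun h 0) 1
  have h11 := congrFun (congrFun h 1) 1
  simp only [toMat, of_apply, cons_val', cons_val_zero, cons_val_one, cons_val_fin_one] at *
  have key : ∀ {a b : ℤ}, a • (1 : Cl n) = b • 1 → a = b := fun {a b} h =>
    (paravec_injective (s := 0) (t := 0) (by simpa [paravec] using h)).1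
  obtain ⟨h1, h2⟩ := paravec_injective h01
  exact Herm.ext (key h00) (key h11) h1 h2

/-- The action of `E(a + t)` on Hermitian matrices in coordinates. -/
def elemPerm (a : ℤ) (t : Fin (n - 1) → ℤ) : Equiv.Perm (Herm n) where
  toFun v := ⟨v.p * (a ^ 2 + t ⬝ᵥ t) + 2 * (a * v.x0 - t ⬝ᵥ v.x) + v.q, v.p,
    -(v.p * a + v.x0), v.x - v.p • t⟩
  invFun v := ⟨v.q, v.p - v.q * (a ^ 2 + t ⬝ᵥ t) -
    2 * (a * (-v.x0 - v.q * a) - t ⬝ᵥ (v.x + v.q • t)), -v.x0 - v.q * a, v.x + v.q • t⟩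
  left_inv v := by
    ext <;> simp
    ring
  right_inv v := by
    ext <;> simp

lemma form_elemPerm (a : ℤ) (t : Fin (n - 1) → ℤ) (v w : Herm n) :
    form (elemPerm a t v) (elemPerm a t w) = form v w := by
  simp only [form, elemPerm, Equiv.coe_fn_mk, sub_dotProduct, dotProduct_sub, smul_dotProduct,
    dotProduct_smul, smul_eq_mul, dotProduct_comm v.x t]
  ring

lemma elemPerm_mem_isometries (a : ℤ) (t : Fin (n - 1) → ℤ) : elemPerm a t ∈ isometries n := by
  refine ⟨form_elemPerm a t, fun v => ?_, fun v => ?_, fun v => ?_⟩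
  · ext <;> simp [elemPerm] <;> ring
  · rw [IsPos, IsPos, form_elemPerm]
    refine and_congr_left fun h => ?_
    have h' := form_elemPerm a t v v
    have hq : (elemPerm a t v).q = v.p := rfl
    have key : ∀ w : Herm n, form w w < 0 → 0 < w.p * w.q := fun w hw => by
      have := dotProduct_self_nonneg_int w.x
      simp only [form] at hw
      nlinarith [mul_self_nonneg w.x0]
    have := key _ (h'.trans_lt h)
    rw [hq] at this
    exact pos_iff_pos_of_mul_pos this
  · rw [IsRoot, IsRoot, form_elemPerm]
    simp only [elemPerm, Equiv.coe_fn_mk]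
    refine and_congr_right fun _ => ?_
    simp only [Int.even_add, even_two, Even.mul_right, Int.even_mul,
      ← Int.not_even_iff_odd, even_neg]
    tauto

lemma toMat_elemPerm (a : ℤ) (t : Fin (n - 1) → ℤ) (v : Herm n) :
    toMat (elemPerm a t v) =
      (Eu n (paravec n a t) : Matrix (Fin 2) (Fin 2) (Cl n)) * toMat v *
        (Eu n (paravec n a t) : Matrix (Fin 2) (Fin 2) (Cl n))ᴴ := by
  ext i j
  fin_cases i <;> fin_cases j <;>
    simp [toMat, Eu, Matrix.mul_apply, Fin.sum_univ_two, star_paravec, elemPerm,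
      -zsmul_eq_mul, -zsmul_one]
  all_goals
    simp only [paravec, map_sub, map_smul, mul_add, add_mul, mul_sub, sub_mul, smul_mul_assoc,
      mul_smul_comm, one_mul, mul_one, ι_Qf_mul_self, ι_Qf_mul_swap v.x t,
      dotProduct_comm v.x t]
    module

lemma exists_perm (g : E2Gamma n) : ∃ f ∈ isometries n, ∀ v, toMat (f v) =
    (g.1 : Matrix (Fin 2) (Fin 2) (Cl n)) * toMat v * (g.1 : Matrix (Fin 2) (Fin 2) (Cl n))ᴴ := by
  obtain ⟨g, hg⟩ := g
  induction hg using Subgroup.closure_induction with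
  | mem g hg =>
    obtain ⟨x, hx, rfl⟩ := hg
    obtain ⟨a, t, rfl⟩ := exists_paravec_of_mem_Vn hx
    exact ⟨_, elemPerm_mem_isometries a t, toMat_elemPerm a t⟩
  | one => exact ⟨1, one_mem _, by simp⟩
  | mul g h _ _ hg hh =>
    obtain ⟨f, hf, hf'⟩ := hg
    obtain ⟨f', hf₂, hf₂'⟩ := hh
    exact ⟨f * f', mul_mem hf hf₂, by simp [hf', hf₂', mul_assoc]⟩
  | inv g _ hg =>
    obtain ⟨f, hf, hf'⟩ := hg
    refine ⟨f⁻¹, inv_mem hf, fun v => ?_⟩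
    have h := hf' (f⁻¹ v)
    rw [show f (f⁻¹ v) = v by simp] at h
    have h1 : ((g⁻¹ : (Matrix (Fin 2) (Fin 2) (Cl n))ˣ) : Matrix (Fin 2) (Fin 2) (Cl n)) * g = 1 :=
      g.inv_mul
    have h2 : (g : Matrix (Fin 2) (Fin 2) (Cl n))ᴴ *
        ((g⁻¹ : (Matrix (Fin 2) (Fin 2) (Cl n))ˣ) : Matrix (Fin 2) (Fin 2) (Cl n))ᴴ = 1 := by
      rw [← conjTranspose_mul, h1, conjTranspose_one]
    rw [h, ← mul_assoc, ← mul_assoc, h1, one_mul, mul_assoc, h2, mul_one]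

variable (n) in
/-- The action of `E₂(Γ_n(ℤ))` on Hermitian matrices by `g • v = g v gᴴ`. -/
def permHom : E2Gamma n →* Equiv.Perm (Herm n) where
  toFun g := (exists_perm g).choose
  map_one' := by
    ext1 v
    apply toMat_injective
    rw [(exists_perm 1).choose_spec.2]
    simp
  map_mul' g h := by
    ext1 v
    apply toMat_injective
    rw [(exists_perm (g * h)).choose_spec.2, Equiv.Perm.mul_apply, (exists_perm g).choose_spec.2,
      (exists_perm h).choose_spec.2]
    simp [mul_assoc]

lemma permHom_eq {a : ℤ} {t : Fin (n - 1) → ℤ} {g : E2Gamma n}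
    (hg : g.1 = Eu n (paravec n a t)) : permHom n g = elemPerm a t := by
  ext1 v
  apply toMat_injective
  rw [toMat_elemPerm, ← hg]
  exact (exists_perm g).choose_spec.2 v

lemma elemPerm_zero_mem_wallStab (t : Fin (n - 1) → ℤ) : elemPerm 0 t ∈ wallStab n := by
  refine ⟨elemPerm_mem_isometries 0 t, Or.inr ?_⟩
  ext <;> simp [elemPerm, e0]

lemma elemPerm_zero_notMem_regionStab (t : Fin (n - 1) → ℤ) : elemPerm 0 t ∉ regionStab n := by
  intro h
  have := apply_e0_of_mem_of_mem h (elemPerm_zero_mem_wallStab t)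
  simp [elemPerm, e0] at this

lemma elemPerm_neg_one_mem_regionStab : elemPerm (-1) 0 ∈ regionStab n := by
  refine ⟨elemPerm_mem_isometries _ _, fun v _ => ?_⟩
  simp only [Up, elemPerm, Equiv.coe_fn_mk, zero_dotProduct]
  constructor <;> intro h <;> linarith

lemma elemPerm_neg_one_notMem_wallStab : elemPerm (-1) 0 ∉ wallStab n := by
  rintro ⟨-, h | h⟩ <;> simp [elemPerm, e0, Herm.ext_iff] at h

end Herm

/-- `E(a + t)` as an element of `E₂(Γ_n(ℤ))`. -/
def elemMat (n : ℕ) (a : ℤ) (t : Fin (n - 1) → ℤ) : E2Gamma n :=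
  ⟨Eu n (paravec n a t), Subgroup.subset_closure ⟨_, paravec_mem_Vn a t, rfl⟩⟩

lemma elemMat_mul_inv_mul (a b : ℤ) (t : Fin (n - 1) → ℤ) :
    elemMat n a t * (elemMat n 0 0)⁻¹ * elemMat n b 0 = elemMat n (a + b) t := by
  apply Subtype.ext
  apply Units.ext
  change !![paravec n a t, 1; -1, 0] * !![0, -1; 1, paravec n 0 0] *
    !![paravec n b 0, 1; -1, 0] = !![paravec n (a + b) t, 1; -1, 0]
  ext i j
  fin_cases i <;> fin_cases j <;> simp [Matrix.mul_apply, Fin.sum_univ_two, paravec]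
  module

lemma eq_top_of_elemMat_mem {H : Subgroup (E2Gamma n)} (h0 : ∀ t, elemMat n 0 t ∈ H)
    (h1 : elemMat n (-1) 0 ∈ H) : H = ⊤ := by
  have h : ∀ a t, elemMat n a t ∈ H := by
    intro a t
    induction a using Int.induction_on with
    | zero => exact h0 t
    | succ a ih =>
      rw [← add_neg_cancel_right (a : ℤ) 1, ← elemMat_mul_inv_mul] at ih
      exact (H.mul_mem_cancel_right (inv_mem (h0 0))).1 ((H.mul_mem_cancel_right h1).1 ih)
    | pred a ih =>
      rw [sub_eq_add_neg, ← elemMat_mul_inv_mul]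
      exact mul_mem (mul_mem ih (inv_mem (h0 0))) h1
  have hle : E2Gamma n ≤ H.map (E2Gamma n).subtype := by
    refine (Subgroup.closure_le _).2 ?_
    rintro _ ⟨x, hx, rfl⟩
    obtain ⟨a, t, rfl⟩ := exists_paravec_of_mem_Vn hx
    exact ⟨elemMat n a t, h a t, rfl⟩
  rw [eq_top_iff]
  rintro ⟨g, hg⟩ -
  obtain ⟨g', hg', rfl⟩ := hle hg
  exact hg'

end Action

/-- For every `n ≥ 1`, the group `E₂(Γ_n(ℤ))` is a nontrivial free product with amalgamation. -/
theorem E2Gamma_isNontrivialAmalgam (n : ℕ) (hn : 1 ≤ n) :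
    IsNontrivialAmalgam ↥(E2Gamma n) := by
  let _ : MulAction (E2Gamma n) (Herm n) := MulAction.compHom _ (Herm.permHom n)
  have h0 : ∀ t, Herm.permHom n (elemMat n 0 t) = Herm.elemPerm 0 t := fun t =>
    Herm.permHom_eq rfl
  have h1 : Herm.permHom n (elemMat n (-1) 0) = Herm.elemPerm (-1) 0 := Herm.permHom_eq rfl
  refine isNontrivialAmalgam_of_pingPong (X := Herm n)
    (A := (Herm.regionStab n).comap (Herm.permHom n))
    (B := (Herm.wallStab n).comap (Herm.permHom n)) (e := (Herm.e0 : Herm n)) (P := Herm.posSide)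
    (N := Herm.negSide) (eq_top_of_elemMat_mem (fun t => ?_) ?_) (fun h => ?_) (fun h => ?_)
    ?_ ?_ ?_ ?_ ?_ ?_ ?_
  · refine Subgroup.mem_sup_right ?_
    rw [Subgroup.mem_comap, h0]
    exact Herm.elemPerm_zero_mem_wallStab t
  · refine Subgroup.mem_sup_left ?_
    rw [Subgroup.mem_comap, h1]
    exact Herm.elemPerm_neg_one_mem_regionStab
  · refine Herm.elemPerm_neg_one_notMem_wallStab (n := n) ?_
    rw [← h1]
    refine h (Subgroup.mem_comap.2 ?_)
    rw [h1]
    exact Herm.elemPerm_neg_one_mem_regionStab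
  · refine Herm.elemPerm_zero_notMem_regionStab (n := n) 0 ?_
    rw [← h0]
    refine h (Subgroup.mem_comap.2 ?_)
    rw [h0]
    exact Herm.elemPerm_zero_mem_wallStab 0
  · simp [Herm.posSide, Herm.e0]
  · simp [Herm.negSide, Herm.e0]
  · exact fun a ha ha' b hb => Herm.apply_apply_e0_mem_posSide ha ha' hb
  · exact fun a ha ha' x hx => Herm.apply_mem_posSide ha ha' hx
  · exact fun b hb hb' x hx => Herm.apply_mem_negSide hb hb' hx
  · exact fun c hc hc' x hx => Herm.apply_mem_posSide_of_mem_of_mem hc hc' hx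
  · exact fun c hc hc' x hx => Herm.apply_mem_negSide_of_mem_of_mem hc hc' hx
end
end

section
/- For every n ≥ 2, the group E₂(Γ_n(ℤ)) has a nontrivial decomposition as a free product with amalgamation whose amalgamated subgroup is E₂(Γ_{n−1}(ℤ)); that is, there exist groups A and B, injective non-surjective group homomorphisms f : E₂(Γ_{n−1}(ℤ)) → A and g : E₂(Γ_{n−1}(ℤ)) → B, and a group isomorphism between E₂(Γ_n(ℤ)) and the amalgamated free product A ∗_{E₂(Γ_{n−1}(ℤ))} B (the pushout of f and g). -/
noncomputable section

open CliffordAlgebra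

/-- Simple roots in a lattice with an integral symmetric form, with pairings as in a simply
laced generalized Cartan matrix, allowing also the affine entry `-2`. -/
structure SimpleRoots (J L : Type*) [AddCommGroup L] where
  form : LinearMap.BilinForm ℤ L
  symm : ∀ x y, form x y = form y x
  root : J → L
  root_self : ∀ i, form (root i) (root i) = 2
  root_ne : ∀ i j, i ≠ j →
    form (root i) (root j) = 0 ∨ form (root i) (root j) = -1 ∨ form (root i) (root j) = -2

namespace SimpleRoots

variable {J L : Type*} [AddCommGroup L] (R : SimpleRoots J L)

/-- The reflection in a simple root. -/
def refl (i : J) : L ≃ₗ[ℤ] L := Module.reflection (f := R.form (R.root i)) (R.root_self i)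

lemma refl_apply (i : J) (x : L) : R.refl i x = x - R.form (R.root i) x • R.root i :=
  Module.reflection_apply _ _

lemma form_refl (i : J) (x y : L) : R.form (R.refl i x) (R.refl i y) = R.form x y := by
  simp only [refl_apply, map_sub, map_smul, LinearMap.sub_apply, LinearMap.smul_apply,
    smul_eq_mul, R.root_self, R.symm x (R.root i)]
  ring

open Classical in
/-- The Coxeter matrix of a family of simple roots. -/
noncomputable def coxeterMatrix : CoxeterMatrix J where
  M := Matrix.of fun i j =>
    if i = j then 1 else if R.form (R.root i) (R.root j) = 0 then 2
      else if R.form (R.root i) (R.root j) = -1 then 3 else 0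
  isSymm := by
    ext i j
    simp [Matrix.transpose_apply, eq_comm (a := j), R.symm (R.root j) (R.root i)]
  diagonal i := by simp
  off_diagonal i j h := by
    simp only [Matrix.of_apply, h, if_false]
    split_ifs <;> simp

lemma coxeterMatrix_apply_of_form_eq_zero {i j : J} (h : R.form (R.root i) (R.root j) = 0) :
    R.coxeterMatrix i j = 2 := by
  have : i ≠ j := by rintro rfl; simp [R.root_self] at h
  simp [coxeterMatrix, this, h]

lemma coxeterMatrix_apply_of_form_eq_neg_one {i j : J}
    (h : R.form (R.root i) (R.root j) = -1) : R.coxeterMatrix i j = 3 := by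
  have : i ≠ j := by rintro rfl; simp [R.root_self] at h
  simp [coxeterMatrix, this, h]

lemma coxeterMatrix_apply_of_form_eq_neg_two {i j : J}
    (h : R.form (R.root i) (R.root j) = -2) : R.coxeterMatrix i j = 0 := by
  have : i ≠ j := by rintro rfl; simp [R.root_self] at h
  simp [coxeterMatrix, this, h]

lemma isLiftable_refl : R.coxeterMatrix.IsLiftable R.refl := by
  intro i j
  by_cases hij : i = j
  · subst hij
    rw [R.coxeterMatrix.diagonal, pow_one]
    exact LinearEquiv.ext fun x => Module.involutive_reflection (R.root_self i) x
  have h' := R.symm (R.root j) (R.root i)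
  rcases R.root_ne i j hij with h | h | h
  · rw [R.coxeterMatrix_apply_of_form_eq_zero h]
    ext x
    simp only [pow_succ, pow_zero, one_mul, LinearEquiv.mul_apply, refl_apply, map_sub, map_smul,
      R.root_self, h', h, LinearEquiv.coe_one, id]
    module
  · rw [R.coxeterMatrix_apply_of_form_eq_neg_one h]
    ext x
    simp only [pow_succ, pow_zero, one_mul, LinearEquiv.mul_apply, refl_apply, map_sub, map_smul,
      R.root_self, h', h, LinearEquiv.coe_one, id]
    module
  · rw [R.coxeterMatrix_apply_of_form_eq_neg_two h, pow_zero]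

/-- The abstract Coxeter group of a family of simple roots. -/
abbrev Weyl : Type _ := R.coxeterMatrix.Group

/-- The standard Coxeter system on the abstract Coxeter group. -/
noncomputable def cs : CoxeterSystem R.coxeterMatrix R.Weyl :=
  R.coxeterMatrix.toCoxeterSystem

/-- The reflection representation. -/
noncomputable def rep : R.Weyl →* (L ≃ₗ[ℤ] L) := R.cs.lift ⟨R.refl, R.isLiftable_refl⟩

@[simp]
lemma rep_simple (i : J) : R.rep (R.cs.simple i) = R.refl i :=
  R.cs.lift_apply_simple R.isLiftable_refl i

lemma rep_mul_simple (w : R.Weyl) (i : J) (x : L) :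
    R.rep (w * R.cs.simple i) x = R.rep w x - R.form (R.root i) x • R.rep w (R.root i) := by
  rw [map_mul, LinearEquiv.mul_apply, rep_simple, refl_apply, map_sub, map_smul]

lemma form_rep (w : R.Weyl) (x y : L) : R.form (R.rep w x) (R.rep w y) = R.form x y := by
  induction w using R.cs.simple_induction_left with
  | one => simp
  | mul_simple_left w i ih => rw [map_mul, LinearEquiv.mul_apply, LinearEquiv.mul_apply,
      rep_simple, form_refl, ih]

/-- The cone of nonnegative combinations of simple roots. -/
def cone : AddSubmonoid L := AddSubmonoid.closure (Set.range R.root)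

lemma root_mem_cone (i : J) : R.root i ∈ R.cone := AddSubmonoid.subset_closure ⟨i, rfl⟩

lemma exists_eq_mul_simple {w : R.Weyl} {i : J} (h : R.cs.IsRightDescent w i) :
    ∃ v, w = v * R.cs.simple i ∧ R.cs.length w = R.cs.length v + 1 ∧
      ¬ R.cs.IsRightDescent v i := by
  refine ⟨w * R.cs.simple i, by simp, ((R.cs.isRightDescent_iff).1 h).symm, ?_⟩
  exact (R.cs.isRightDescent_iff_not_isRightDescent_mul).1 h

lemma not_isRightDescent_of_not_isRightDescent {w : R.Weyl} {i : J} (n : ℕ)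
    (h : ∀ v : R.Weyl, R.cs.length v < n → ∀ i, ¬ R.cs.IsRightDescent v i →
      R.rep v (R.root i) ∈ R.cone) (hw : R.cs.length w < n) {j : J}
    (hij : R.form (R.root i) (R.root j) = -2) :
    R.rep w (R.root i) + R.rep w (R.root j) ∈ R.cone := by
  induction hl : R.cs.length w using Nat.strong_induction_on generalizing w with
  | _ l ih =>
    have hji := (R.symm (R.root j) (R.root i)).trans hij
    by_cases hi : R.cs.IsRightDescent w i
    · obtain ⟨v, rfl, hv, -⟩ := R.exists_eq_mul_simple hi
      have := ih (R.cs.length v) (by omega) (w := v) (by omega) rfl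
      convert this using 1
      simp only [rep_mul_simple, hij, R.root_self]
      module
    by_cases hj : R.cs.IsRightDescent w j
    · obtain ⟨v, rfl, hv, -⟩ := R.exists_eq_mul_simple hj
      have := ih (R.cs.length v) (by omega) (w := v) (by omega) rfl
      convert this using 1
      simp only [rep_mul_simple, hji, R.root_self]
      module
    exact add_mem (h w hw i hi) (h w hw j hj)

/-- The image of a simple root under a Coxeter group element of which it is not a right descent
is positive. -/
theorem rep_root_mem_cone (w : R.Weyl) (i : J) (hi : ¬ R.cs.IsRightDescent w i) :
    R.rep w (R.root i) ∈ R.cone := by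
  induction hn : R.cs.length w using Nat.strong_induction_on generalizing w i with
  | _ n IH =>
    subst hn
    replace IH : ∀ v : R.Weyl, R.cs.length v < R.cs.length w →
        ∀ i, ¬ R.cs.IsRightDescent v i → R.rep v (R.root i) ∈ R.cone :=
      fun v hv i hi => IH _ hv v i hi rfl
    by_cases hw : w = 1
    · subst hw; simpa using R.root_mem_cone i
    obtain ⟨j, hj⟩ := R.cs.exists_rightDescent_of_ne_one hw
    have hij : i ≠ j := by rintro rfl; exact hi hj
    have hiw := R.cs.not_isRightDescent_iff.1 hi
    obtain ⟨u, rfl, hu, huj⟩ := R.exists_eq_mul_simple hj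
    have hfs := R.symm (R.root i) (R.root j)
    rw [rep_mul_simple]
    rcases R.root_ne i j hij with h | h | h
    · rw [← hfs, h, zero_smul, sub_zero]
      apply IH u (by omega)
      intro hui
      obtain ⟨v, rfl, hv, -⟩ := R.exists_eq_mul_simple hui
      have hc : R.cs.simple i * R.cs.simple j * R.cs.simple i = R.cs.simple j := by
        have := R.cs.simple_mul_simple_pow i j
        rw [R.coxeterMatrix_apply_of_form_eq_zero h, pow_two, ← mul_assoc] at this
        simpa using congrArg (· * R.cs.simple j) this
      have h1 : v * R.cs.simple i * R.cs.simple j * R.cs.simple i = v * R.cs.simple j := by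
        rw [mul_assoc, mul_assoc, ← mul_assoc (R.cs.simple i), hc]
      have h2 := R.cs.length_mul_le v (R.cs.simple j)
      rw [R.cs.length_simple] at h2
      rw [h1] at hiw
      omega
    · rw [← hfs, h, neg_one_smul, sub_neg_eq_add]
      by_cases hui : R.cs.IsRightDescent u i
      · obtain ⟨v, rfl, hv, hvi⟩ := R.exists_eq_mul_simple hui
        have : R.rep (v * R.cs.simple i) (R.root i) + R.rep (v * R.cs.simple i) (R.root j)
            = R.rep v (R.root j) := by
          simp only [rep_mul_simple, h, R.root_self]
          module
        rw [this]
        apply IH v (by omega)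
        intro hvj
        obtain ⟨x, rfl, hx, -⟩ := R.exists_eq_mul_simple hvj
        have hc : R.cs.simple j * R.cs.simple i * R.cs.simple j * R.cs.simple i =
            R.cs.simple i * R.cs.simple j := by
          have := R.cs.simple_mul_simple_pow j i
          rw [R.coxeterMatrix_apply_of_form_eq_neg_one (hfs.symm.trans h), pow_succ, pow_two]
            at this
          replace this := congrArg (· * R.cs.simple i * R.cs.simple j) this
          simpa [mul_assoc] using this
        have h1 : x * R.cs.simple j * R.cs.simple i * R.cs.simple j * R.cs.simple i =
            x * (R.cs.simple i * R.cs.simple j) := by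
          rw [← hc]; simp only [mul_assoc]
        have h2 := R.cs.length_mul_le x (R.cs.simple i * R.cs.simple j)
        have h3 := R.cs.length_mul_le (R.cs.simple i) (R.cs.simple j)
        rw [R.cs.length_simple, R.cs.length_simple] at h3
        rw [h1] at hiw
        omega
      · exact add_mem (IH u (by omega) i hui) (IH u (by omega) j huj)
    · rw [← hfs, h]
      have := R.not_isRightDescent_of_not_isRightDescent _ IH (w := u) (by omega) h
      have := add_mem this (IH u (by omega) j huj)
      convert this using 1
      module

/-- The orbit of a vector pairing to `0` with all simple roots but one, and to `-2` with that
one. -/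
theorem rep_eq_add_two_smul (v : L) (b : J) (hb : R.form (R.root b) v = -2)
    (hv : ∀ i, i ≠ b → R.form (R.root i) v = 0) (w : R.Weyl) :
    ∃ k ∈ R.cone, R.rep w v = v + (2 : ℤ) • k ∧ R.form v k ≤ 0 ∧
      (w ∈ Subgroup.closure (R.cs.simple '' {b}ᶜ) ∨ R.form v k ≤ -2) := by
  have hcone : ∀ k ∈ R.cone, R.form v k ≤ 0 := by
    intro k hk
    induction hk using AddSubmonoid.closure_induction with
    | mem x hx =>
      obtain ⟨i, rfl⟩ := hx
      rw [R.symm]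
      by_cases h : i = b
      · subst h; simp [hb]
      · rw [hv i h]
    | zero => simp
    | add x y _ _ hx hy => rw [map_add]; omega
  have hfix : ∀ w ∈ Subgroup.closure (R.cs.simple '' {b}ᶜ), R.rep w v = v := by
    intro w hw
    induction hw using Subgroup.closure_induction with
    | mem x hx =>
      obtain ⟨i, hi, rfl⟩ := hx
      rw [rep_simple, refl_apply, hv i hi]; simp
    | one => simp
    | mul x y _ _ hx hy => rw [map_mul, LinearEquiv.mul_apply, hy, hx]
    | inv x _ hx =>
      rw [map_inv]
      exact (LinearEquiv.symm_apply_eq _).2 hx.symm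
  suffices h : ∃ k ∈ R.cone, R.rep w v = v + (2 : ℤ) • k ∧
      (w ∈ Subgroup.closure (R.cs.simple '' {b}ᶜ) ∨ R.form v k ≤ -2) by
    obtain ⟨k, hk, h1, h2⟩ := h
    exact ⟨k, hk, h1, hcone k hk, h2⟩
  induction hn : R.cs.length w using Nat.strong_induction_on generalizing w with
  | _ n IH =>
    by_cases hw : w = 1
    · subst hw
      exact ⟨0, zero_mem _, by simp, Or.inl (one_mem _)⟩
    obtain ⟨j, hj⟩ := R.cs.exists_rightDescent_of_ne_one hw
    obtain ⟨u, rfl, hu, huj⟩ := R.exists_eq_mul_simple hj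
    obtain ⟨k, hk, hk1, hk2⟩ := IH _ (by omega) u rfl
    by_cases hjb : j = b
    · subst hjb
      have hp := R.rep_root_mem_cone u j huj
      refine ⟨k + R.rep u (R.root j), add_mem hk hp, ?_, Or.inr ?_⟩
      · rw [rep_mul_simple, hb, hk1]; module
      · rw [map_add]
        have h1 := hcone k hk
        have h2 := hcone _ hp
        rcases hk2 with hk2 | hk2
        · have : R.form v (R.rep u (R.root j)) = -2 := by
            conv_lhs => rw [← hfix u hk2]
            rw [form_rep, R.symm, hb]
          omega
        · omega
    · refine ⟨k, hk, ?_, ?_⟩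
      · rw [rep_mul_simple, hv j hjb, hk1]; simp
      · exact hk2.imp_left fun h => mul_mem h (Subgroup.subset_closure ⟨j, hjb, rfl⟩)

end SimpleRoots

namespace Monoid.PushoutI

open NormalWord

lemma NormalWord.prod_eq_base_of_fstIdx_eq_none {ι H : Type*} {G : ι → Type*} [Group H]
    [∀ i, Group (G i)] {φ : ∀ i, H →* G i} {d : Transversal φ} {w : NormalWord d}
    (hw : w.fstIdx = none) : w.prod = base φ w.head := by
  obtain ⟨⟨l, h1, h2⟩, h, h3⟩ := w
  have : l = [] := by simpa [CoprodI.Word.fstIdx] using hw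
  subst this
  simp [NormalWord.prod, CoprodI.Word.prod]

variable {C Γ X : Type*} [Group C] [Group Γ] [MulAction Γ X] {G : Bool → Type*}
  [∀ i, Group (G i)] {φ : ∀ i, C →* G i} {f : ∀ i, G i →* Γ} {k : C →* Γ}

/-- The position of the images of a point under normal words, according to the first letter. -/
lemma lift_prod_smul_mem (hf : ∀ i, (f i).comp (φ i) = k) {P N T : Set X}
    (hCP : ∀ c, ∀ x ∈ P, k c • x ∈ P) (hCT : ∀ c, ∀ x ∈ T, k c • x ∈ T)
    (hAP : ∀ a, a ∉ (φ true).range → ∀ x ∈ P, f true a • x ∈ N)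
    (hBN : ∀ b, b ∉ (φ false).range → ∀ x ∈ N, f false b • x ∈ P)
    (hNT : N ⊆ T) (hT : ∀ x ∈ T, x ∈ N ∨ ∀ b, f false b • x ∈ P)
    {x : X} (hx : x ∈ N ∨ ∀ b, f false b • x ∈ P)
    (hxT : ∀ a, a ∉ (φ true).range → f true a • x ∈ T) {d : Transversal φ}
    (w : NormalWord d) :
    (w.fstIdx = some true → lift f k hf w.prod • x ∈ T) ∧
      (w.fstIdx = some false → lift f k hf w.prod • x ∈ P) := by
  classical
  induction w using NormalWord.consRecOn with
  | empty => simp [CoprodI.Word.fstIdx, NormalWord.empty, CoprodI.Word.empty]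
  | cons i g w hmw hgn hgr hw1 ih =>
    obtain ⟨h1, h2⟩ := ih
    have hfst : (NormalWord.cons g w hmw hgr).fstIdx = some i := by
      simp [CoprodI.Word.fstIdx, NormalWord.cons, CoprodI.Word.cons]
    have hnone : w.fstIdx = none → lift f k hf w.prod = 1 := fun h => by
      rw [prod_eq_base_of_fstIdx_eq_none h, hw1, map_one, map_one]
    rw [hfst, NormalWord.prod_cons, map_mul, lift_of, mul_smul]
    have hor : ∀ y, (y ∈ N ∨ ∀ b, f false b • y ∈ P) → ∀ b, b ∉ (φ false).range →
        f false b • y ∈ P := fun y hy b hb => hy.elim (hBN b hb y) fun h => h b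
    cases i with
    | false =>
      refine ⟨by simp, fun _ => ?_⟩
      rcases h : w.fstIdx with _ | _ | _
      · rw [hnone h, one_smul]
        exact hor x hx g hgr
      · exact absurd h hmw
      · exact hor _ (hT _ (h1 h)) g hgr
    | true =>
      refine ⟨fun _ => ?_, by simp⟩
      rcases h : w.fstIdx with _ | _ | _
      · rw [hnone h, one_smul]
        exact hxT g hgr
      · exact hNT (hAP g hgr _ (h2 h))
      · exact absurd h hmw
  | base h w hw ih =>
    have hfst : (base φ h • w).fstIdx = w.fstIdx := by
      rw [base_smul_eq_smul, base_smul_def']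
    rw [hfst, prod_smul, map_mul, lift_base, mul_smul]
    exact ⟨fun e => hCT h _ (ih.1 e), fun e => hCP h _ (ih.2 e)⟩

/-- A ping-pong criterion for amalgamated products of two groups. -/
theorem lift_injective_of_ping_pong (hφ : ∀ i, Function.Injective (φ i))
    (hf : ∀ i, (f i).comp (φ i) = k) (hk : Function.Injective k) {P N : Set X}
    (hPN : Disjoint P N) (hCP : ∀ c, ∀ x ∈ P, k c • x ∈ P) (hCN : ∀ c, ∀ x ∈ N, k c • x ∈ N)
    (hAP : ∀ a, a ∉ (φ true).range → ∀ x ∈ P, f true a • x ∈ N)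
    (hBN : ∀ b, b ∉ (φ false).range → ∀ x ∈ N, f false b • x ∈ P)
    {x₀ : X} (hx₀ : ∀ b, f false b • x₀ ∈ P) (hA : ¬ Function.Surjective (φ true)) :
    Function.Injective (lift f k hf) := by
  classical
  obtain ⟨d⟩ := transversal_nonempty φ hφ
  have hkA : ∀ c, f true (φ true c) = k c := fun c => DFunLike.congr_fun (hf true) c
  have hkB : ∀ c, f false (φ false c) = k c := fun c => DFunLike.congr_fun (hf false) c
  have hx₀P : x₀ ∈ P := by simpa using hx₀ 1
  obtain ⟨a₀, ha₀⟩ : ∃ a, a ∉ (φ true).range := by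
    by_contra! h
    exact hA fun a => h a
  have hx₁ : f true a₀ • x₀ ∈ N := hAP a₀ ha₀ x₀ hx₀P
  refine (injective_iff_map_eq_one _).2 fun g hg => ?_
  obtain ⟨w, rfl⟩ : ∃ w : NormalWord d, w.prod = g := ⟨g • NormalWord.empty, by simp⟩
  rcases h : w.fstIdx with _ | _ | _
  · rw [prod_eq_base_of_fstIdx_eq_none h] at hg ⊢
    rw [lift_base, ← map_one k] at hg
    rw [hk hg, map_one]
  · have := (lift_prod_smul_mem hf (T := N ∪ {x | ∀ b, f false b • x ∈ P}) hCP ?_ hAP hBN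
      Set.subset_union_left (fun _ h => h) (Or.inl hx₁) ?_ w).2 h
    · rw [hg, one_smul] at this
      exact absurd hx₁ (Set.disjoint_left.1 hPN this)
    · rintro c x (hx | hx)
      · exact Or.inl (hCN c x hx)
      · refine Or.inr fun b => ?_
        rw [← hkB, ← mul_smul, ← map_mul]
        exact hx _
    · intro a ha
      rw [← mul_smul, ← map_mul]
      by_cases haa : a * a₀ ∈ (φ true).range
      · obtain ⟨c, hc⟩ := haa
        refine Or.inr fun b => ?_
        rw [← hc, hkA, ← hkB, ← mul_smul, ← map_mul]
        exact hx₀ _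
      · exact Or.inl (hAP _ haa _ hx₀P)
  · have := (lift_prod_smul_mem hf (T := N) hCP hCN hAP hBN subset_rfl (fun _ h => Or.inl h)
      (Or.inr hx₀) (fun a ha => hAP a ha _ hx₀P) w).1 h
    rw [hg, one_smul] at this
    exact absurd this (Set.disjoint_left.1 hPN hx₀P)

end Monoid.PushoutI

/-- The negative of the standard sum of squares on `ℤ^d`. -/
def stdForm (d : ℕ) : QuadraticForm ℤ (Fin d → ℤ) :=
  QuadraticMap.weightedSumSquares ℤ (fun _ : Fin d => (-1 : ℤ))

lemma stdForm_apply (d : ℕ) (x : Fin d → ℤ) : stdForm d x = -(x ⬝ᵥ x) := by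
  simp [stdForm, dotProduct]

lemma polar_stdForm (d : ℕ) (x y : Fin d → ℤ) :
    QuadraticMap.polar (stdForm d) x y = -2 * (x ⬝ᵥ y) := by
  simp only [QuadraticMap.polar, stdForm_apply, add_dotProduct, dotProduct_add,
    dotProduct_comm y x]
  ring

/-- The Clifford algebra of `stdForm d`. -/
abbrev StdCl (d : ℕ) := CliffordAlgebra (stdForm d)

namespace StdCl

variable {d : ℕ}

lemma ι_mul_ι_self (x : Fin d → ℤ) :
    ι (stdForm d) x * ι (stdForm d) x = algebraMap ℤ (StdCl d) (-(x ⬝ᵥ x)) := by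
  rw [ι_sq_scalar, stdForm_apply]

lemma ι_mul_ι_add (x y : Fin d → ℤ) :
    ι (stdForm d) x * ι (stdForm d) y + ι (stdForm d) y * ι (stdForm d) x =
      algebraMap ℤ (StdCl d) (-2 * (x ⬝ᵥ y)) := by
  rw [ι_mul_ι_add_swap, polar_stdForm]

lemma dotProduct_fin_succ (x y : Fin (d + 1) → ℤ) :
    x ⬝ᵥ y = (x ∘ Fin.castSucc) ⬝ᵥ (y ∘ Fin.castSucc) + x (Fin.last d) * y (Fin.last d) := by
  simp [dotProduct, Fin.sum_univ_castSucc]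

lemma snoc_comp_castSucc {M : Type*} (x : Fin d → M) (y : M) :
    (Fin.snoc x y : Fin (d + 1) → M) ∘ Fin.castSucc = x := by
  ext i; simp

lemma eq_snoc_add_single (x : Fin (d + 1) → ℤ) :
    x = (Fin.snoc (x ∘ Fin.castSucc) 0 : Fin (d + 1) → ℤ) +
      x (Fin.last d) • Pi.single (Fin.last d) 1 := by
  ext i
  refine Fin.lastCases ?_ (fun j => ?_) i <;> simp

/-- Extension of a vector by zero. -/
def snocZero (d : ℕ) : (Fin d → ℤ) →ₗ[ℤ] (Fin (d + 1) → ℤ) where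
  toFun x := Fin.snoc x 0
  map_add' x y := by ext i; refine Fin.lastCases ?_ (fun j => ?_) i <;> simp
  map_smul' c x := by ext i; refine Fin.lastCases ?_ (fun j => ?_) i <;> simp

lemma snocZero_apply (x : Fin d → ℤ) : snocZero d x = Fin.snoc x 0 := rfl

/-- The inclusion of `StdCl d` in `StdCl (d + 1)`. -/
def incl (d : ℕ) : StdCl d →ₐ[ℤ] StdCl (d + 1) :=
  CliffordAlgebra.lift (stdForm d) ⟨ι (stdForm (d + 1)) ∘ₗ snocZero d, fun x => by
    simp only [LinearMap.comp_apply, ι_mul_ι_self, stdForm_apply, snocZero_apply]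
    rw [dotProduct_fin_succ, snoc_comp_castSucc]
    simp⟩

@[simp]
lemma incl_ι (x : Fin d → ℤ) :
    incl d (ι (stdForm d) x) = ι (stdForm (d + 1)) (Fin.snoc x 0 : Fin (d + 1) → ℤ) :=
  CliffordAlgebra.lift_ι_apply _ _ _

/-- The last generator. -/
def gen (d : ℕ) : StdCl (d + 1) := ι (stdForm (d + 1)) (Pi.single (Fin.last d) 1)

lemma gen_mul_gen : gen d * gen d = -1 := by
  rw [gen, ι_mul_ι_self]
  simp

lemma ι_succ (x : Fin (d + 1) → ℤ) : ι (stdForm (d + 1)) x =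
    incl d (ι (stdForm d) (x ∘ Fin.castSucc)) + x (Fin.last d) • gen d := by
  rw [incl_ι, gen, ← map_zsmul, ← map_add, ← eq_snoc_add_single]

lemma single_last_comp_castSucc :
    (Pi.single (Fin.last d) 1 : Fin (d + 1) → ℤ) ∘ Fin.castSucc = 0 := by
  ext i; simp

lemma gen_mul_incl (p : StdCl d) : gen d * incl d p = incl d (involute p) * gen d := by
  induction p using CliffordAlgebra.induction with
  | algebraMap r => rw [AlgHom.commutes, AlgHom.commutes, AlgHom.commutes, Algebra.commutes]
  | ι x =>
    have h := ι_mul_ι_add (Pi.single (Fin.last d) 1) (Fin.snoc x 0 : Fin (d + 1) → ℤ)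
    rw [dotProduct_fin_succ, single_last_comp_castSucc] at h
    rw [involute_ι, map_neg, incl_ι, gen, neg_mul]
    simpa [add_eq_zero_iff_eq_neg] using h
  | mul a b ha hb => rw [map_mul, ← mul_assoc, ha, mul_assoc, hb, map_mul, map_mul, mul_assoc]
  | add a b ha hb => rw [map_add, mul_add, ha, hb, map_add, map_add, add_mul]

lemma involute_incl (p : StdCl d) : involute (incl d p) = incl d (involute p) := by
  induction p using CliffordAlgebra.induction with
  | algebraMap r => simp
  | ι x => simp
  | mul a b ha hb => simp only [map_mul, ha, hb]
  | add a b ha hb => simp only [map_add, ha, hb]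

lemma involute_gen : involute (gen d) = -gen d := involute_ι _

/-- The representation of `StdCl (d + 1)` on its decomposition `StdCl d ⊕ StdCl d`. -/
def double (d : ℕ) : StdCl (d + 1) →ₐ[ℤ] Matrix (Fin 2) (Fin 2) (StdCl d) :=
  CliffordAlgebra.lift (stdForm (d + 1)) ⟨
    { toFun := fun x => !![ι (stdForm d) (x ∘ Fin.castSucc), algebraMap ℤ _ (x (Fin.last d));
        -algebraMap ℤ _ (x (Fin.last d)), -ι (stdForm d) (x ∘ Fin.castSucc)]
      map_add' := fun x y => by
        ext i j
        fin_cases i <;> fin_cases j <;> simp [Pi.add_comp, add_comm]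
      map_smul' := fun c x => by
        have : (c • x) ∘ Fin.castSucc = c • (x ∘ (Fin.castSucc : Fin d → Fin (d + 1))) := rfl
        rw [this, map_zsmul, Pi.smul_apply, map_zsmul, Matrix.smul_of]
        simp },
    fun x => by
      ext i j
      fin_cases i <;> fin_cases j <;>
        simp [Matrix.algebraMap_matrix_apply, Matrix.mul_apply, Fin.sum_univ_two, stdForm_apply,
          dotProduct_fin_succ x, ← Int.cast_comm (x (Fin.last d))]
      abel⟩

lemma double_ι (x : Fin (d + 1) → ℤ) : double d (ι (stdForm (d + 1)) x) =
    !![ι (stdForm d) (x ∘ Fin.castSucc), algebraMap ℤ _ (x (Fin.last d));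
        -algebraMap ℤ _ (x (Fin.last d)), -ι (stdForm d) (x ∘ Fin.castSucc)] :=
  CliffordAlgebra.lift_ι_apply _ _ _

lemma double_incl (p : StdCl d) : double d (incl d p) = !![p, 0; 0, involute p] := by
  induction p using CliffordAlgebra.induction with
  | algebraMap r =>
    rw [AlgHom.commutes, AlgHom.commutes, AlgHom.commutes]
    ext i j
    fin_cases i <;> fin_cases j <;>
      simp only [Matrix.algebraMap_matrix_apply] <;> rfl
  | ι x => rw [incl_ι, double_ι, snoc_comp_castSucc]; simp
  | mul a b ha hb => rw [map_mul, map_mul, ha, hb]; simp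
  | add a b ha hb => rw [map_add, map_add, ha, hb]; simp

lemma double_gen : double d (gen d) = !![0, 1; -1, 0] := by
  rw [gen, double_ι, single_last_comp_castSucc]
  simp

lemma double_decomp (p r : StdCl d) :
    double d (incl d p + incl d r * gen d) = !![p, r; -involute r, involute p] := by
  rw [map_add, map_mul, double_incl, double_incl, double_gen]
  simp

lemma exists_decomp (p : StdCl (d + 1)) : ∃ x y, p = incl d x + incl d y * gen d := by
  induction p using CliffordAlgebra.induction with
  | algebraMap r => exact ⟨algebraMap _ _ r, 0, by simp⟩
  | ι x => 
    exact ⟨ι _ (x ∘ Fin.castSucc), algebraMap ℤ _ (x (Fin.last d)), by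
      rw [ι_succ, AlgHom.commutes, Algebra.smul_def]⟩
  | mul a b ha hb =>
    obtain ⟨x, y, rfl⟩ := ha
    obtain ⟨z, t, rfl⟩ := hb
    refine ⟨x * z - y * involute t, x * t + y * involute z, ?_⟩
    simp only [map_neg, map_add, map_mul, add_mul, mul_add, sub_eq_add_neg]
    have h1 : incl d y * gen d * incl d z = incl d y * incl d (involute z) * gen d := by
      rw [mul_assoc, gen_mul_incl, mul_assoc]
    have h2 : incl d y * gen d * (incl d t * gen d) = -(incl d y * incl d (involute t)) := by
      rw [mul_assoc, ← mul_assoc (gen d), gen_mul_incl, mul_assoc (incl d _) (gen d), gen_mul_gen]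
      simp
    rw [h1, h2, ← mul_assoc]
    abel_nf
  | add a b ha hb =>
    obtain ⟨x, y, rfl⟩ := ha
    obtain ⟨z, t, rfl⟩ := hb
    exact ⟨x + z, y + t, by simp only [map_add, add_mul]; abel⟩

lemma decomp_inj {x y z t : StdCl d}
    (h : incl d x + incl d y * gen d = incl d z + incl d t * gen d) : x = z ∧ y = t := by
  have := congrArg (double d) h
  rw [double_decomp, double_decomp] at this
  exact ⟨congrFun (congrFun this 0) 0, congrFun (congrFun this 0) 1⟩

lemma incl_injective : Function.Injective (incl d) := fun x y h =>
  (decomp_inj (y := 0) (t := 0) (by simpa using h)).1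

lemma algebraMap_injective (d : ℕ) : Function.Injective (algebraMap ℤ (StdCl d)) := by
  induction d with
  | zero =>
    let g : StdCl 0 →ₐ[ℤ] ℤ := CliffordAlgebra.lift (stdForm 0) ⟨0, fun x => by
      simp [stdForm_apply]⟩
    intro x y h
    simpa using congrArg g h
  | succ d ih =>
    intro x y h
    exact ih (incl_injective (by simpa using h))

lemma exists_eq_algebraMap_zero (p : StdCl 0) : ∃ z : ℤ, p = algebraMap ℤ _ z := by
  induction p using CliffordAlgebra.induction with
  | algebraMap r => exact ⟨r, rfl⟩
  | ι x => exact ⟨0, by rw [Subsingleton.elim x 0, map_zero, map_zero]⟩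
  | mul a b ha hb =>
    obtain ⟨x, rfl⟩ := ha
    obtain ⟨y, rfl⟩ := hb
    exact ⟨x * y, by simp⟩
  | add a b ha hb =>
    obtain ⟨x, rfl⟩ := ha
    obtain ⟨y, rfl⟩ := hb
    exact ⟨x + y, by simp⟩

lemma eq_zero_of_eq_neg {d : ℕ} {p : StdCl d} (h : p = -p) : p = 0 := by
  induction d with
  | zero =>
    obtain ⟨z, rfl⟩ := exists_eq_algebraMap_zero p
    rw [← map_neg] at h
    have := algebraMap_injective 0 h
    rw [show z = 0 by omega, map_zero]
  | succ d ih =>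
    obtain ⟨x, y, rfl⟩ := exists_decomp p
    have h' : incl d x + incl d y * gen d = incl d (-x) + incl d (-y) * gen d := by
      rw [h]; simp only [map_neg, neg_mul]; abel
    obtain ⟨hx, hy⟩ := decomp_inj h'
    rw [ih hx, ih hy]
    simp

/-- An even element commuting with all vectors is an integer. -/
lemma exists_eq_algebraMap {d : ℕ} {p : StdCl d} (hp : involute p = p)
    (hc : ∀ x, p * ι (stdForm d) x = ι (stdForm d) x * p) : ∃ z : ℤ, p = algebraMap ℤ _ z := by
  induction d with
  | zero => exact exists_eq_algebraMap_zero p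
  | succ d ih =>
    obtain ⟨x, y, rfl⟩ := exists_decomp p
    have h1 : incl d (involute x) + incl d (-involute y) * gen d
        = incl d x + incl d y * gen d := by
      rw [← hp]
      simp only [map_add, map_mul, involute_incl, involute_gen, map_neg, neg_mul, mul_neg]
    obtain ⟨hx, hy⟩ := decomp_inj h1
    have h2 : incl d (-y) + incl d x * gen d
        = incl d (-involute y) + incl d (involute x) * gen d := by
      have := hc (Pi.single (Fin.last d) 1)
      rw [← gen, add_mul, mul_add, mul_assoc, gen_mul_gen, gen_mul_incl, ← mul_assoc,
        gen_mul_incl, mul_assoc, gen_mul_gen] at this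
      simp only [map_neg]
      simp only [mul_neg, mul_one] at this
      rw [add_comm (-(incl d y)), add_comm (-(incl d (involute y)))]
      exact this
    have hy0 : y = 0 := eq_zero_of_eq_neg (by
      have := (decomp_inj h2).1
      rw [hy] at this
      exact this.symm)
    subst hy0
    simp only [map_zero, zero_mul, add_zero] at hc ⊢
    obtain ⟨z, rfl⟩ := ih hx fun v => incl_injective (by
      rw [map_mul, map_mul, incl_ι, hc])
    exact ⟨z, by simp⟩

/-- The paravector with real part `x none` and vector part `x ∘ some`. -/
def vec (d : ℕ) : (Option (Fin d) → ℤ) →ₗ[ℤ] StdCl d :=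
  Algebra.linearMap ℤ (StdCl d) ∘ₗ LinearMap.proj none +
    ι (stdForm d) ∘ₗ LinearMap.funLeft ℤ ℤ some

lemma vec_apply (x : Option (Fin d) → ℤ) :
    vec d x = algebraMap ℤ _ (x none) + ι (stdForm d) (x ∘ some) := rfl

lemma star_vec (x : Option (Fin d) → ℤ) :
    star (vec d x) = algebraMap ℤ _ (x none) - ι (stdForm d) (x ∘ some) := by
  rw [vec_apply, star_add, star_algebraMap, star_ι, sub_eq_add_neg]

lemma involute_vec (x : Option (Fin d) → ℤ) : involute (vec d x) = star (vec d x) := by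
  rw [star_vec, vec_apply, map_add, AlgHom.commutes, involute_ι, sub_eq_add_neg]

lemma dotProduct_option (x y : Option (Fin d) → ℤ) :
    x ⬝ᵥ y = x none * y none + (x ∘ some) ⬝ᵥ (y ∘ some) := by
  simp [dotProduct, Fintype.sum_option]

lemma vec_mul_star_vec (x : Option (Fin d) → ℤ) :
    vec d x * star (vec d x) = algebraMap ℤ _ (x ⬝ᵥ x) := by
  rw [star_vec, vec_apply, add_mul, mul_sub, mul_sub, ι_mul_ι_self, dotProduct_option, map_add,
    map_mul, map_neg, Algebra.commutes (x none) (ι _ _)]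
  abel

lemma vec_mul_star_vec_add (x y : Option (Fin d) → ℤ) :
    vec d x * star (vec d y) + vec d y * star (vec d x) = algebraMap ℤ _ (2 * (x ⬝ᵥ y)) := by
  have h := vec_mul_star_vec (x + y)
  have e : (x + y) ⬝ᵥ (x + y) = x ⬝ᵥ x + 2 * (x ⬝ᵥ y) + y ⬝ᵥ y := by
    rw [add_dotProduct, dotProduct_add, dotProduct_add, dotProduct_comm y x]; ring
  rw [e, map_add, map_add (algebraMap ℤ _), map_add (algebraMap ℤ _), ← vec_mul_star_vec x,
    ← vec_mul_star_vec y, star_add, add_mul,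
    mul_add, mul_add] at h
  have h' : vec d x * star (vec d x) + (vec d x * star (vec d y) + vec d y * star (vec d x)) +
      vec d y * star (vec d y) = vec d x * star (vec d x) + algebraMap ℤ _ (2 * (x ⬝ᵥ y)) +
      vec d y * star (vec d y) := by rw [← h]; abel
  exact add_left_cancel (add_right_cancel h')

lemma vec_injective : Function.Injective (vec d) := by
  rw [injective_iff_map_eq_zero]
  intro x hx
  have h := vec_mul_star_vec x
  rw [hx, zero_mul, ← map_zero (algebraMap ℤ _)] at h
  exact dotProduct_self_eq_zero.1 (algebraMap_injective d h).symm

/-- The lattice of Hermitian `2 × 2` matrices with paravector entries. -/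
abbrev Lat (d : ℕ) := ℤ × ℤ × (Option (Fin d) → ℤ)

/-- The Hermitian matrix with diagonal `(p.1, p.2.1)` and upper right entry `p.2.2`. -/
def emb (p : Lat d) : Matrix (Fin 2) (Fin 2) (StdCl d) :=
  !![algebraMap ℤ _ p.1, vec d p.2.2; star (vec d p.2.2), algebraMap ℤ _ p.2.1]

lemma emb_injective : Function.Injective (emb (d := d)) := by
  rintro ⟨r, t, x⟩ ⟨r', t', x'⟩ h
  have h1 := algebraMap_injective d (congrFun (congrFun h 0) 0)
  have h2 := algebraMap_injective d (congrFun (congrFun h 1) 1)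
  have h3 := vec_injective (congrFun (congrFun h 0) 1)
  simp only [Prod.mk.injEq]
  exact ⟨h1, h2, h3⟩

/-- The polarization of minus twice the determinant. -/
def latForm (d : ℕ) : LinearMap.BilinForm ℤ (Lat d) :=
  LinearMap.mk₂ ℤ (fun p q => 2 * (p.2.2 ⬝ᵥ q.2.2) - p.1 * q.2.1 - p.2.1 * q.1)
    (fun p p' q => by simp only [Prod.fst_add, Prod.snd_add, add_dotProduct]; ring)
    (fun c p q => by simp only [Prod.smul_fst, Prod.smul_snd, smul_dotProduct, smul_eq_mul]; ring)
    (fun p q q' => by simp only [Prod.fst_add, Prod.snd_add, dotProduct_add]; ring)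
    (fun c p q => by simp only [Prod.smul_fst, Prod.smul_snd, dotProduct_smul, smul_eq_mul]; ring)

lemma latForm_apply (p q : Lat d) :
    latForm d p q = 2 * (p.2.2 ⬝ᵥ q.2.2) - p.1 * q.2.1 - p.2.1 * q.1 := rfl

/-- The roots: `none` exchanges the diagonal entries, `some (true, κ)` changes the sign of the
coordinate `κ`, and `some (false, κ)` is the affine root corresponding to it. -/
def latRoot (d : ℕ) : Option (Bool × Option (Fin d)) → Lat d
  | none => (1, -1, 0)
  | some (true, κ) => (0, 0, Pi.single κ 1)
  | some (false, κ) => (-1, 0, -Pi.single κ 1)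

/-- The root system formed by all the roots `latRoot`. -/
def latRoots (d : ℕ) : SimpleRoots (Option (Bool × Option (Fin d))) (Lat d) where
  form := latForm d
  symm p q := by rw [latForm_apply, latForm_apply, dotProduct_comm]; ring
  root := latRoot d
  root_self i := by
    rcases i with _ | ⟨_ | _, κ⟩ <;> simp [latForm_apply, latRoot]
  root_ne i j h := by
    rcases i with _ | ⟨_ | _, κ⟩ <;> rcases j with _ | ⟨_ | _, κ'⟩ <;>
      simp only [latForm_apply, latRoot]
    · exact absurd rfl h
    · simp
    · simp
    · simp
    · rcases eq_or_ne κ κ' with rfl | h'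
      · exact absurd rfl h
      · simp [h']
    · rcases eq_or_ne κ κ' with rfl | h'
      · simp
      · simp [h']
    · simp
    · rcases eq_or_ne κ κ' with rfl | h'
      · simp
      · simp [h']
    · rcases eq_or_ne κ κ' with rfl | h'
      · exact absurd rfl h
      · simp [h']

lemma refl_none (p : Lat d) : (latRoots d).refl none p = (p.2.1, p.1, p.2.2) := by
  obtain ⟨r, t, x⟩ := p
  rw [SimpleRoots.refl_apply]
  simp [latRoots, latRoot, latForm_apply]

lemma refl_true (κ : Option (Fin d)) (p : Lat d) :
    (latRoots d).refl (some (true, κ)) p =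
      (p.1, p.2.1, p.2.2 - (2 * p.2.2 κ) • Pi.single κ 1) := by
  obtain ⟨r, t, x⟩ := p
  rw [SimpleRoots.refl_apply]
  simp [latRoots, latRoot, latForm_apply]

lemma refl_false (κ : Option (Fin d)) (p : Lat d) :
    (latRoots d).refl (some (false, κ)) p =
      (p.1 + (p.2.1 - 2 * p.2.2 κ), p.2.1, p.2.2 + (p.2.1 - 2 * p.2.2 κ) • Pi.single κ 1) := by
  obtain ⟨r, t, x⟩ := p
  rw [SimpleRoots.refl_apply]
  simp [latRoots, latRoot, latForm_apply]
  constructor <;> ring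

end StdCl

section ElementaryUnits

variable {R : Type*} [Ring R]

/-- The elementary unit `!![x, 1; -1, 0]`. -/
def elemUnit (x : R) : (Matrix (Fin 2) (Fin 2) R)ˣ where
  val := !![x, 1; -1, 0]
  inv := !![0, -1; 1, x]
  val_inv := by simp [Matrix.one_fin_two]
  inv_val := by simp [Matrix.one_fin_two]

/-- The transvection `!![1, x; 0, 1]`. -/
def upperUnit (x : R) : (Matrix (Fin 2) (Fin 2) R)ˣ where
  val := !![1, x; 0, 1]
  inv := !![1, -x; 0, 1]
  val_inv := by simp [Matrix.one_fin_two]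
  inv_val := by simp [Matrix.one_fin_two]

/-- The diagonal matrix `diag(a, -a)` with `a ^ 2 = -1`. -/
def diagUnit (a : R) (ha : a * a = -1) : (Matrix (Fin 2) (Fin 2) R)ˣ where
  val := !![a, 0; 0, -a]
  inv := !![-a, 0; 0, a]
  val_inv := by simp [Matrix.one_fin_two, ha]
  inv_val := by simp [Matrix.one_fin_two, ha]

lemma elemUnit_eq (x : R) : elemUnit x = upperUnit (-x) * elemUnit 0 := by
  ext1; simp [elemUnit, upperUnit]

lemma upperUnit_eq (x : R) : upperUnit x = elemUnit (-x) * (elemUnit 0)⁻¹ := by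
  rw [elemUnit_eq]; simp

lemma upperUnit_add (x y : R) : upperUnit (x + y) = upperUnit x * upperUnit y := by
  ext1; simp [upperUnit, add_comm]

lemma upperUnit_zero : upperUnit (0 : R) = 1 := by
  ext1; simp [upperUnit, Matrix.one_fin_two]

lemma upperUnit_neg (x : R) : upperUnit (-x) = (upperUnit x)⁻¹ :=
  eq_inv_of_mul_eq_one_left (by rw [← upperUnit_add, neg_add_cancel, upperUnit_zero])

lemma elemUnit_zero_mul_self : elemUnit (0 : R) * elemUnit 0 = -1 := by
  ext1; simp [elemUnit, Matrix.one_fin_two]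

lemma diagUnit_eq (a : R) (ha : a * a = -1) :
    diagUnit a ha = elemUnit (-a) * elemUnit a * elemUnit (-a) := by
  ext1; simp [elemUnit, diagUnit, ha]

lemma diagUnit_mul_self (a : R) (ha : a * a = -1) : diagUnit a ha * diagUnit a ha = -1 := by
  ext1; simp [diagUnit, Matrix.one_fin_two, ha]

lemma diagUnit_mul_elemUnit (a : R) (ha : a * a = -1) {x y : R} (h : a * x = -y * a) :
    diagUnit a ha * elemUnit x * (diagUnit a ha)⁻¹ = -1 * elemUnit y := by
  rw [mul_inv_eq_iff_eq_mul]
  ext1; simp [elemUnit, diagUnit, h]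

end ElementaryUnits

namespace StdCl

variable {d : ℕ}

/-- The pairs of a unit and an automorphism of the lattice acting compatibly on matrices. -/
def pairs (d : ℕ) : Subgroup ((Matrix (Fin 2) (Fin 2) (StdCl d))ˣ × (Lat d ≃ₗ[ℤ] Lat d)) where
  carrier := {g | ∀ p, emb (g.2 p) =
    (g.1 : Matrix (Fin 2) (Fin 2) (StdCl d)) * emb p * star (g.1 : Matrix (Fin 2) (Fin 2) (StdCl d))}
  one_mem' p := by simp
  mul_mem' {g h} hg hh p := by
    rw [Prod.snd_mul, LinearEquiv.mul_apply, hg, hh, Prod.fst_mul, Units.val_mul, star_mul]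
    simp only [mul_assoc]
  inv_mem' {g} hg p := by
    have h := hg (g⁻¹.2 p)
    rw [Prod.snd_inv, ← LinearEquiv.mul_apply, mul_inv_cancel, LinearEquiv.coe_one, id] at h
    rw [h, Prod.snd_inv, Prod.fst_inv, ← mul_assoc, ← mul_assoc, Units.inv_mul, one_mul, mul_assoc,
      ← star_mul, Units.inv_mul, star_one, mul_one]

lemma mem_pairs {g : (Matrix (Fin 2) (Fin 2) (StdCl d))ˣ} {T : Lat d ≃ₗ[ℤ] Lat d} :
    (g, T) ∈ pairs d ↔ ∀ p, emb (T p) = (g : Matrix (Fin 2) (Fin 2) (StdCl d)) * emb p *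
      star (g : Matrix (Fin 2) (Fin 2) (StdCl d)) := Iff.rfl

lemma vec_single_none : vec d (Pi.single none 1) = 1 := by
  rw [vec_apply, show (Pi.single none 1 : Option (Fin d) → ℤ) ∘ some = 0 by ext; simp]
  simp

lemma single_some_comp (k : Fin d) :
    (Pi.single (some k) 1 : Option (Fin d) → ℤ) ∘ some = Pi.single k 1 := by
  ext j; simp [Pi.single_apply]

lemma vec_single_some (k : Fin d) :
    vec d (Pi.single (some k) 1) = ι (stdForm d) (Pi.single k 1) := by
  rw [vec_apply, single_some_comp]
  simp

lemma star_ι_single (k : Fin d) :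
    star (ι (stdForm d) (Pi.single k 1)) = -ι (stdForm d) (Pi.single k 1) := star_ι _

lemma ι_single_mul_self (k : Fin d) :
    ι (stdForm d) (Pi.single k 1) * ι (stdForm d) (Pi.single k 1) = -1 := by
  rw [ι_mul_ι_self]; simp

lemma emb_eq_mul_mul_star {a b c e : StdCl d} {p q : Lat d}
    (h₁ : algebraMap ℤ _ q.1 =
      (a * algebraMap ℤ _ p.1 + b * star (vec d p.2.2)) * star a +
        (a * vec d p.2.2 + b * algebraMap ℤ _ p.2.1) * star b)
    (h₂ : vec d q.2.2 =
      (a * algebraMap ℤ _ p.1 + b * star (vec d p.2.2)) * star c +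
        (a * vec d p.2.2 + b * algebraMap ℤ _ p.2.1) * star e)
    (h₃ : algebraMap ℤ _ q.2.1 =
      (c * algebraMap ℤ _ p.1 + e * star (vec d p.2.2)) * star c +
        (c * vec d p.2.2 + e * algebraMap ℤ _ p.2.1) * star e) :
    emb q = !![a, b; c, e] * emb p * star !![a, b; c, e] := by
  have hs : star !![a, b; c, e] = !![star a, star c; star b, star e] := by
    ext i j; fin_cases i <;> fin_cases j <;> rfl
  have h₂' := congrArg star h₂
  simp only [star_add, star_mul, star_star, star_algebraMap] at h₂'
  rw [hs, emb, emb, Matrix.mul_fin_two, Matrix.mul_fin_two, ← h₁, ← h₂, ← h₃, h₂']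
  congr 3
  simp only [add_mul, mul_add, mul_assoc]
  abel_nf

lemma elemUnit_mem_pairs : (elemUnit (0 : StdCl d),
    (latRoots d).refl none * (latRoots d).refl (some (true, none))) ∈ pairs d := by
  rw [mem_pairs]
  rintro ⟨r, t, x⟩
  have hv : vec d (x - (2 * x none) • Pi.single none 1) = -star (vec d x) := by
    rw [map_sub, map_zsmul, vec_single_none, star_vec, vec_apply, two_mul, add_smul,
      ← Algebra.algebraMap_eq_smul_one]
    abel
  rw [LinearEquiv.mul_apply, refl_true, refl_none]
  refine emb_eq_mul_mul_star ?_ ?_ ?_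
  · simp
  · simp only [hv]; simp
  · simp

lemma upperUnit_mem_pairs (κ : Option (Fin d)) : (upperUnit (vec d (Pi.single κ 1)),
    (latRoots d).refl (some (false, κ)) * (latRoots d).refl (some (true, κ))) ∈ pairs d := by
  rw [mem_pairs]
  rintro ⟨r, t, x⟩
  have h₁ := vec_mul_star_vec_add (Pi.single κ 1) x
  have h₂ := vec_mul_star_vec (d := d) (Pi.single κ 1)
  set e : Option (Fin d) → ℤ := Pi.single κ 1 with he
  have hκ : (x - (2 * x κ) • e) κ = -x κ := by
    simp [he]; ring
  have hv : x - (2 * x κ) • e + (t - 2 * -x κ) • e = x + t • e := by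
    module
  rw [single_dotProduct, one_mul] at h₁
  rw [single_dotProduct, one_mul, he, Pi.single_eq_same, ← he, map_one] at h₂
  rw [LinearEquiv.mul_apply, refl_true, refl_false, ← he]
  refine emb_eq_mul_mul_star ?_ ?_ ?_
  · simp only [hκ]
    rw [star_one, mul_one, one_mul, one_mul, add_mul, mul_assoc, Algebra.commutes t, ← mul_assoc,
      h₂, one_mul, add_assoc, ← add_assoc (_ * _) (_ * _), h₁, ← map_add, ← map_add]
    congr 1
    ring
  · simp only [hκ, hv, map_add, map_zsmul, star_zero, star_one, mul_zero, mul_one, zero_add,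
      one_mul]
    rw [← Algebra.commutes, ← Algebra.smul_def]
  · simp

lemma diagUnit_mem_pairs (k : Fin d) :
    (diagUnit _ (ι_single_mul_self k),
    (latRoots d).refl (some (true, some k)) * (latRoots d).refl (some (true, none))) ∈ pairs d := by
  rw [mem_pairs]
  rintro ⟨r, t, x⟩
  have h := ι_mul_ι_add (Pi.single k 1) (x ∘ some)
  have h' := ι_single_mul_self k
  have hs := star_ι_single k
  have hk := vec_single_some k
  set i := ι (stdForm d) (Pi.single k 1)
  have hv : (x - (2 * x none) • (Pi.single none 1 : Option (Fin d) → ℤ)) (some k) = x (some k) := by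
    simp
  rw [single_dotProduct, one_mul, Function.comp_apply] at h
  rw [LinearEquiv.mul_apply, refl_true, refl_true]
  refine emb_eq_mul_mul_star (a := i) (b := 0) (c := 0) (e := -i) ?_ ?_ ?_
  · rw [hs, ← Algebra.commutes]
    simp [mul_assoc, h']
  · simp only [hv, map_sub, map_zsmul, hk, vec_single_none, star_neg, hs, neg_neg, star_zero,
      mul_zero, zero_mul, add_zero, zero_add]
    have h₁ : i * ι (stdForm d) (x ∘ some) =
        algebraMap ℤ _ (-2 * x (some k)) - ι (stdForm d) (x ∘ some) * i := by rw [← h]; abel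
    rw [vec_apply, mul_add, add_mul, ← Algebra.commutes, mul_assoc, h', h₁, sub_mul, mul_assoc, h',
      ← Algebra.smul_def, ← Algebra.smul_def, neg_mul, neg_smul, mul_neg, mul_one,
      Algebra.algebraMap_eq_smul_one]
    module
  · rw [star_neg, hs, neg_neg, zero_mul, zero_mul, star_zero, mul_zero, zero_add,
      ← Algebra.commutes, zero_add, mul_assoc, neg_mul, h', neg_neg, mul_one]

/-- The group generated by the elementary units `!![x, 1; -1, 0]` with `x` a paravector. -/
def elemGroup (d : ℕ) : Subgroup (Matrix (Fin 2) (Fin 2) (StdCl d))ˣ :=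
  Subgroup.closure (Set.range fun x => elemUnit (vec d x))

lemma star_mul_mul_involute {g : (Matrix (Fin 2) (Fin 2) (StdCl d))ˣ} (hg : g ∈ elemGroup d) :
    star (g : Matrix (Fin 2) (Fin 2) (StdCl d)) * !![0, 1; -1, 0] *
      involute.mapMatrix (g : Matrix (Fin 2) (Fin 2) (StdCl d)) = !![0, 1; -1, 0] := by
  induction hg using Subgroup.closure_induction with
  | mem g hg =>
    obtain ⟨x, rfl⟩ := hg
    have h₁ : star !![vec d x, 1; -1, 0] = !![star (vec d x), -1; 1, 0] := by
      ext i j; fin_cases i <;> fin_cases j <;> simp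
    have h₂ : involute.mapMatrix !![vec d x, 1; -1, 0] = !![star (vec d x), 1; -1, 0] := by
      ext i j; fin_cases i <;> fin_cases j <;> simp [involute_vec]
    simp only [elemUnit]
    rw [h₁, h₂]
    simp
  | one => simp
  | mul g h _ _ hg hh =>
    rw [Units.val_mul, star_mul, map_mul]
    rw [mul_assoc (star _), mul_assoc (star _), ← mul_assoc _ (involute.mapMatrix _), hg,
      ← mul_assoc, hh]
  | inv g _ hg =>
    have h₁ : star ((g⁻¹ : (Matrix (Fin 2) (Fin 2) (StdCl d))ˣ) : Matrix (Fin 2) (Fin 2) (StdCl d)) *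
        star (g : Matrix (Fin 2) (Fin 2) (StdCl d)) = 1 := by
      rw [← star_mul, Units.mul_inv, star_one]
    have h₂ : involute.mapMatrix (g : Matrix (Fin 2) (Fin 2) (StdCl d)) *
        involute.mapMatrix ((g⁻¹ : (Matrix (Fin 2) (Fin 2) (StdCl d))ˣ) :
          Matrix (Fin 2) (Fin 2) (StdCl d)) = 1 := by
      rw [← map_mul, Units.mul_inv, map_one]
    conv_lhs => rw [← hg]
    rw [← mul_assoc, ← mul_assoc, h₁, one_mul, mul_assoc, h₂, mul_one]

lemma exists_eq_of_mem_pairs_one {g : (Matrix (Fin 2) (Fin 2) (StdCl d))ˣ} (hg : g ∈ elemGroup d)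
    (h : (g, 1) ∈ pairs d) : ∃ z : ℤ, (g : Matrix (Fin 2) (Fin 2) (StdCl d)) =
      !![algebraMap ℤ _ z, 0; 0, algebraMap ℤ _ z] := by
  have key (p : Lat d) : emb p * !![0, 1; -1, 0] * involute.mapMatrix
      (g : Matrix (Fin 2) (Fin 2) (StdCl d)) =
      (g : Matrix (Fin 2) (Fin 2) (StdCl d)) * (emb p * !![0, 1; -1, 0]) := by
    conv_lhs => rw [show emb p = _ from h p]
    conv_rhs => rw [← star_mul_mul_involute hg]
    simp only [mul_assoc]
  obtain ⟨a, b, c, e, hM⟩ : ∃ a b c e, (g : Matrix (Fin 2) (Fin 2) (StdCl d)) = !![a, b; c, e] :=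
    ⟨_, _, _, _, Matrix.eta_fin_two _⟩
  have hI : involute.mapMatrix !![a, b; c, e] =
      !![involute a, involute b; involute c, involute e] := by
    ext i j; fin_cases i <;> fin_cases j <;> rfl
  have key' (p : Lat d) := key p
  simp only [hM, hI, emb, Matrix.mul_fin_two] at key'
  have h₁ := key' (1, 0, 0)
  have h₂ := key' (0, 1, 0)
  have h₃ (x) := key' (0, 0, x)
  simp at h₁ h₂ h₃
  obtain ⟨⟨-, hea⟩, rfl⟩ := h₁
  obtain ⟨rfl, hae, -⟩ := h₂
  have haa : involute a = a := by
    simpa [vec_single_none] using (h₃ (Pi.single none 1)).1.1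
  obtain ⟨z, rfl⟩ := exists_eq_algebraMap haa fun x => by
    have := (h₃ fun k => k.elim 0 x).1.1
    rw [haa, vec_apply, show (fun k : Option (Fin d) => k.elim 0 x) ∘ some = x from rfl] at this
    simpa using this.symm
  exact ⟨z, by rw [hM, ← hae, haa]⟩

lemma eq_one_or_neg_one {g : (Matrix (Fin 2) (Fin 2) (StdCl d))ˣ} (hg : g ∈ elemGroup d)
    (h : (g, 1) ∈ pairs d) : g = 1 ∨ g = -1 := by
  obtain ⟨z, hz⟩ := exists_eq_of_mem_pairs_one hg h
  obtain ⟨y, hy⟩ := exists_eq_of_mem_pairs_one (inv_mem hg)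
    (by simpa using (pairs d).inv_mem h)
  have hzy := g.mul_inv
  rw [hz, hy, Matrix.mul_fin_two] at hzy
  have := congrFun (congrFun hzy 0) 0
  simp only [zero_mul, add_zero, ← map_mul] at this
  have hzy' : z * y = 1 := algebraMap_injective d (by simpa using this)
  rcases Int.eq_one_or_neg_one_of_mul_eq_one hzy' with rfl | rfl
  · left; ext1; rw [hz, Units.val_one, Matrix.one_fin_two, map_one]
  · right; ext1; rw [hz, Units.val_neg, Units.val_one, Matrix.one_fin_two, map_neg, map_one]; simp

/-- A subgroup containing the elementary unit of `0` and the transvections along the coordinates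
in the support of `x` contains the elementary unit of `x`. -/
lemma elemUnit_vec_mem {H : Subgroup (Matrix (Fin 2) (Fin 2) (StdCl d))ˣ}
    (h₀ : elemUnit (0 : StdCl d) ∈ H) {x : Option (Fin d) → ℤ}
    (h : ∀ κ, x κ ≠ 0 → upperUnit (vec d (Pi.single κ 1)) ∈ H) : elemUnit (vec d x) ∈ H := by
  let S : AddSubgroup (Option (Fin d) → ℤ) :=
    { carrier := {y | upperUnit (vec d y) ∈ H}
      add_mem' := fun {y z} hy hz => by
        rw [Set.mem_ofPred_eq, map_add, upperUnit_add]; exact H.mul_mem hy hz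
      zero_mem' := by rw [Set.mem_ofPred_eq, map_zero, upperUnit_zero]; exact H.one_mem
      neg_mem' := fun {y} hy => by
        rw [Set.mem_ofPred_eq, map_neg, upperUnit_neg]; exact H.inv_mem hy }
  have hx : x ∈ S := by
    rw [pi_eq_sum_univ' x]
    refine S.sum_mem fun κ _ => ?_
    rcases eq_or_ne (x κ) 0 with h0 | h0
    · rw [h0, zero_smul]; exact S.zero_mem
    · refine S.zsmul_mem ?_ _
      convert show Pi.single κ 1 ∈ S from h κ h0 using 1
  rw [elemUnit_eq, ← map_neg]
  exact H.mul_mem (S.neg_mem hx) h₀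

lemma elemUnit_mem_elemGroup (x : Option (Fin d) → ℤ) : elemUnit (vec d x) ∈ elemGroup d :=
  Subgroup.subset_closure ⟨x, rfl⟩

lemma elemUnit_zero_mem_elemGroup : elemUnit (0 : StdCl d) ∈ elemGroup d := by
  simpa using elemUnit_mem_elemGroup (d := d) 0

lemma upperUnit_mem_elemGroup (x : Option (Fin d) → ℤ) : upperUnit (vec d x) ∈ elemGroup d := by
  rw [upperUnit_eq, ← map_neg]
  exact mul_mem (elemUnit_mem_elemGroup _) (inv_mem elemUnit_zero_mem_elemGroup)

lemma diagUnit_mem_elemGroup (k : Fin d) : diagUnit _ (ι_single_mul_self k) ∈ elemGroup d := by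
  rw [diagUnit_eq, ← vec_single_some, ← map_neg]
  exact mul_mem (mul_mem (elemUnit_mem_elemGroup _) (elemUnit_mem_elemGroup _))
    (elemUnit_mem_elemGroup _)

end StdCl

namespace SimpleRoots

variable {J L : Type*} [AddCommGroup L] (R : SimpleRoots J L)

lemma refl_mul_self (i : J) : R.refl i * R.refl i = 1 := by
  ext1 x
  exact Module.involutive_reflection _ x

/-- A subfamily of a family of simple roots. -/
def restrict (p : J → Prop) : SimpleRoots {j // p j} L where
  form := R.form
  symm := R.symm
  root j := R.root j
  root_self j := R.root_self j
  root_ne i j h := R.root_ne i j (Subtype.coe_injective.ne h)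

variable {R} {Γ : Type*} [Group Γ]

/-- The elements of a group `Γ` acting on the lattice, by a correspondence `P`, as the even
elements of a subgroup of the Weyl group. -/
def evenLifts (P : Subgroup (Γ × (L ≃ₗ[ℤ] L))) (S : Subgroup R.Weyl) : Subgroup Γ where
  carrier := {g | ∃ w ∈ S, R.cs.lengthParity w = 1 ∧ (g, R.rep w) ∈ P}
  one_mem' := ⟨1, one_mem _, map_one _, by rw [map_one]; exact one_mem P⟩
  mul_mem' := by
    rintro g h ⟨w, hw, hw', hg⟩ ⟨v, hv, hv', hh⟩
    exact ⟨w * v, mul_mem hw hv, by rw [map_mul, hw', hv', one_mul], by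
      rw [map_mul]; exact P.mul_mem hg hh⟩
  inv_mem' := by
    rintro g ⟨w, hw, hw', hg⟩
    exact ⟨w⁻¹, inv_mem hw, by rw [map_inv, hw', inv_one], by
      rw [map_inv]; exact P.inv_mem hg⟩

lemma mem_evenLifts_of_refl {P : Subgroup (Γ × (L ≃ₗ[ℤ] L))} {S : Subgroup R.Weyl} {g : Γ} (i j)
    (hi : R.cs.simple i ∈ S) (hj : R.cs.simple j ∈ S) (h : (g, R.refl i * R.refl j) ∈ P) :
    g ∈ evenLifts P S := by
  refine ⟨_, mul_mem hi hj, ?_, ?_⟩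
  · rw [map_mul, CoxeterSystem.lengthParity_simple, CoxeterSystem.lengthParity_simple]
    rfl
  · rwa [map_mul, rep_simple, rep_simple]

end SimpleRoots

namespace StdCl

variable {d : ℕ}

/-- The group of invertible `2 × 2` matrices over `StdCl d`. -/
abbrev UnitMat (d : ℕ) := (Matrix (Fin 2) (Fin 2) (StdCl d))ˣ

/-- The group generated by the elementary units of the paravectors with last coordinate zero. -/
def subElemGroup (d : ℕ) : Subgroup (UnitMat (d + 1)) :=
  Subgroup.closure {g | ∃ x, x (some (Fin.last d)) = 0 ∧ elemUnit (vec (d + 1) x) = g}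

lemma incl_vec (x : Option (Fin d) → ℤ) :
    incl d (vec d x) = vec (d + 1) (fun k => k.elim (x none) (snocZero d (x ∘ some))) := by
  rw [vec_apply, vec_apply, map_add, AlgHom.commutes, incl_ι]
  rfl

lemma map_elemUnit (x : StdCl d) :
    Units.map (incl d).mapMatrix.toMonoidHom (elemUnit x) = elemUnit (incl d x) := by
  ext1
  ext i j
  fin_cases i <;> fin_cases j <;> simp [elemUnit]

lemma subElemGroup_eq_map :
    subElemGroup d = (elemGroup d).map (Units.map (incl d).mapMatrix.toMonoidHom) := by
  rw [subElemGroup, elemGroup, MonoidHom.map_closure]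
  congr 1
  ext g
  constructor
  · rintro ⟨x, hx, rfl⟩
    refine ⟨_, ⟨fun k => k.elim (x none) fun i => x (some i.castSucc), rfl⟩, ?_⟩
    rw [map_elemUnit, incl_vec]
    congr 2
    ext k
    rcases k with _ | k
    · rfl
    · refine Fin.lastCases ?_ (fun j => ?_) k
      · simp [snocZero_apply, hx]
      · simp [snocZero_apply]
  · rintro ⟨_, ⟨x, rfl⟩, rfl⟩
    refine ⟨_, ?_, by rw [map_elemUnit, incl_vec]⟩
    simp [snocZero_apply]

lemma elemUnit_mem_subElemGroup {x : Option (Fin (d + 1)) → ℤ} (hx : x (some (Fin.last d)) = 0) :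
    elemUnit (vec (d + 1) x) ∈ subElemGroup d := Subgroup.subset_closure ⟨x, hx, rfl⟩

lemma elemUnit_zero_mem_subElemGroup : elemUnit (0 : StdCl (d + 1)) ∈ subElemGroup d := by
  simpa using elemUnit_mem_subElemGroup (d := d) (x := 0) rfl

lemma neg_one_mem_subElemGroup : (-1 : UnitMat (d + 1)) ∈ subElemGroup d := by
  rw [← elemUnit_zero_mul_self]
  exact mul_mem elemUnit_zero_mem_subElemGroup elemUnit_zero_mem_subElemGroup

lemma upperUnit_mem_subElemGroup {x : Option (Fin (d + 1)) → ℤ}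
    (hx : x (some (Fin.last d)) = 0) : upperUnit (vec (d + 1) x) ∈ subElemGroup d := by
  rw [upperUnit_eq, ← map_neg]
  exact mul_mem (elemUnit_mem_subElemGroup (by simp [hx])) (inv_mem elemUnit_zero_mem_subElemGroup)

lemma diagUnit_mem_subElemGroup {k : Fin (d + 1)} (hk : k ≠ Fin.last d) :
    diagUnit _ (ι_single_mul_self k) ∈ subElemGroup d := by
  have h : (Pi.single (some k) 1 : Option (Fin (d + 1)) → ℤ) (some (Fin.last d)) = 0 := by
    simp [hk.symm]
  rw [diagUnit_eq, ← vec_single_some, ← map_neg]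
  exact mul_mem (mul_mem (elemUnit_mem_subElemGroup (by simp [h])) (elemUnit_mem_subElemGroup h))
    (elemUnit_mem_subElemGroup (by simp [h]))

lemma subElemGroup_le_elemGroup : subElemGroup d ≤ elemGroup (d + 1) :=
  Subgroup.closure_le _ |>.2 fun _ ⟨x, _, hx⟩ => hx ▸ elemUnit_mem_elemGroup x

/-- The subgroup `subElemGroup d` is contained in a subgroup containing the elementary unit of
`0` and the transvections along all the coordinates but the last. -/
lemma subElemGroup_le {H : Subgroup (UnitMat (d + 1))} (h₀ : elemUnit (0 : StdCl (d + 1)) ∈ H)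
    (h : ∀ κ, κ ≠ some (Fin.last d) → upperUnit (vec (d + 1) (Pi.single κ 1)) ∈ H) :
    subElemGroup d ≤ H := by
  rw [subElemGroup, Subgroup.closure_le]
  rintro _ ⟨x, hx, rfl⟩
  exact elemUnit_vec_mem h₀ fun κ hκ => h κ (by rintro rfl; exact hκ hx)

/-- The diagonal matrix `diag(i, -i)`, with `i` the last generator. -/
def diagLast (d : ℕ) : UnitMat (d + 1) := diagUnit _ (ι_single_mul_self (Fin.last d))

/-- The transvection with entry the last generator. -/
def upperLast (d : ℕ) : UnitMat (d + 1) :=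
  upperUnit (vec (d + 1) (Pi.single (some (Fin.last d)) 1))

/-- The roots without the linear root of the last coordinate. -/
def partRoots (d : ℕ) : SimpleRoots {j : Option (Bool × Option (Fin (d + 1))) //
    j ≠ some (true, some (Fin.last d))} (Lat (d + 1)) :=
  (latRoots (d + 1)).restrict _

/-- The affine root of the last coordinate. -/
def bLast (d : ℕ) : {j : Option (Bool × Option (Fin (d + 1))) //
    j ≠ some (true, some (Fin.last d))} := ⟨some (false, some (Fin.last d)), by simp⟩

lemma refl_partRoots (j) : (partRoots d).refl j = (latRoots (d + 1)).refl j := rfl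

/-- The standard parabolic subgroup of the roots not involving the last coordinate. -/
def parabolic (d : ℕ) : Subgroup (partRoots d).Weyl :=
  Subgroup.closure ((partRoots d).cs.simple '' {bLast d}ᶜ)

lemma simple_mem_parabolic {j} (hj : j ≠ bLast d) :
    (partRoots d).cs.simple j ∈ parabolic d := Subgroup.subset_closure ⟨j, hj, rfl⟩

lemma subElemGroup_le_evenLifts : subElemGroup d ≤
    SimpleRoots.evenLifts (pairs (d + 1)) (parabolic d) := by
  refine subElemGroup_le ?_ fun κ hκ => ?_
  · exact SimpleRoots.mem_evenLifts_of_refl ⟨none, by simp⟩ ⟨some (true, none), by simp⟩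
      (simple_mem_parabolic (by simp [bLast])) (simple_mem_parabolic (by simp [bLast]))
      elemUnit_mem_pairs
  · exact SimpleRoots.mem_evenLifts_of_refl ⟨some (false, κ), by simp⟩
      ⟨some (true, κ), by simp [hκ]⟩
      (simple_mem_parabolic (by simp [bLast, hκ])) (simple_mem_parabolic (by simp [bLast]))
      (upperUnit_mem_pairs κ)

lemma upperLast_mul_diagLast_mem_pairs : (upperLast d * diagLast d,
    (latRoots (d + 1)).refl (some (false, some (Fin.last d))) *
      (latRoots (d + 1)).refl (some (true, none))) ∈ pairs (d + 1) := by
  have := (pairs (d + 1)).mul_mem (upperUnit_mem_pairs (some (Fin.last d)))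
    (diagUnit_mem_pairs (Fin.last d))
  rwa [Prod.mk_mul_mk, mul_assoc, ← mul_assoc ((latRoots (d + 1)).refl (some (true, _))),
    SimpleRoots.refl_mul_self, one_mul] at this

/-- The vertex group containing the diagonal matrix of the last generator. -/
def vertexA (d : ℕ) : Subgroup (UnitMat (d + 1)) :=
  Subgroup.closure (insert (diagLast d) (subElemGroup d))

/-- The vertex group containing the product of the transvection and the diagonal matrix of the
last generator. -/
def vertexB (d : ℕ) : Subgroup (UnitMat (d + 1)) :=
  Subgroup.closure (insert (upperLast d * diagLast d) (subElemGroup d))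

lemma vertexB_le_evenLifts : vertexB d ≤
    SimpleRoots.evenLifts (R := partRoots d) (pairs (d + 1)) ⊤ := by
  rw [vertexB, Subgroup.closure_le, Set.insert_subset_iff]
  constructor
  · exact SimpleRoots.mem_evenLifts_of_refl (bLast d) ⟨some (true, none), by simp⟩
      (Subgroup.mem_top _) (Subgroup.mem_top _) upperLast_mul_diagLast_mem_pairs
  · intro g hg
    obtain ⟨w, -, hw⟩ := subElemGroup_le_evenLifts hg
    exact ⟨w, Subgroup.mem_top _, hw⟩

/-- The automorphisms of the lattice induced by `subElemGroup d`. -/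
def autSub (d : ℕ) : Subgroup (Lat (d + 1) ≃ₗ[ℤ] Lat (d + 1)) :=
  (pairs (d + 1) ⊓ (subElemGroup d).prod ⊤).map (MonoidHom.snd _ _)

lemma mem_autSub {T : Lat (d + 1) ≃ₗ[ℤ] Lat (d + 1)} :
    T ∈ autSub d ↔ ∃ g ∈ subElemGroup d, (g, T) ∈ pairs (d + 1) := by
  constructor
  · rintro ⟨⟨g, T⟩, ⟨h, hg, -⟩, rfl⟩
    exact ⟨g, hg, h⟩
  · rintro ⟨g, hg, h⟩
    exact ⟨(g, T), ⟨h, hg, trivial⟩, rfl⟩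

lemma refl_mul_refl_mem_autSub (j : Option (Bool × Option (Fin (d + 1))))
    (h₁ : j ≠ some (true, some (Fin.last d))) (h₂ : j ≠ some (false, some (Fin.last d))) :
    (latRoots (d + 1)).refl j * (latRoots (d + 1)).refl (some (true, none)) ∈ autSub d := by
  rcases j with _ | ⟨_ | _, _ | k⟩
  · exact mem_autSub.2 ⟨_, elemUnit_zero_mem_subElemGroup, elemUnit_mem_pairs⟩
  · exact mem_autSub.2 ⟨_, upperUnit_mem_subElemGroup (by simp), upperUnit_mem_pairs _⟩
  · have hk : k ≠ Fin.last d := by rintro rfl; exact h₂ rfl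
    have h := (autSub d).mul_mem
      (mem_autSub.2 ⟨_, upperUnit_mem_subElemGroup (by simp [hk.symm]),
        upperUnit_mem_pairs (some k)⟩)
      (mem_autSub.2 ⟨_, diagUnit_mem_subElemGroup hk, diagUnit_mem_pairs k⟩)
    rwa [mul_assoc, ← mul_assoc ((latRoots (d + 1)).refl (some (true, _))),
      SimpleRoots.refl_mul_self, one_mul] at h
  · rw [SimpleRoots.refl_mul_self]
    exact one_mem _
  · have hk : k ≠ Fin.last d := by rintro rfl; exact h₁ rfl
    exact mem_autSub.2 ⟨_, diagUnit_mem_subElemGroup hk, diagUnit_mem_pairs k⟩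

lemma rep_mem_autSub {w : (partRoots d).Weyl} (hw : w ∈ parabolic d) :
    ((partRoots d).cs.lengthParity w = 1 ∧ (partRoots d).rep w ∈ autSub d) ∨
      ((partRoots d).cs.lengthParity w = Multiplicative.ofAdd 1 ∧
        (partRoots d).rep w * (latRoots (d + 1)).refl (some (true, none)) ∈ autSub d) := by
  have key (w) (j) (hj : j ≠ bLast d)
      (hw : ((partRoots d).cs.lengthParity w = 1 ∧ (partRoots d).rep w ∈ autSub d) ∨
      ((partRoots d).cs.lengthParity w = Multiplicative.ofAdd 1 ∧
        (partRoots d).rep w * (latRoots (d + 1)).refl (some (true, none)) ∈ autSub d)) :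
      ((partRoots d).cs.lengthParity (w * (partRoots d).cs.simple j) = 1 ∧
        (partRoots d).rep (w * (partRoots d).cs.simple j) ∈ autSub d) ∨
      ((partRoots d).cs.lengthParity (w * (partRoots d).cs.simple j) = Multiplicative.ofAdd 1 ∧
        (partRoots d).rep (w * (partRoots d).cs.simple j) *
          (latRoots (d + 1)).refl (some (true, none)) ∈ autSub d) := by
    have hj' := refl_mul_refl_mem_autSub j.1 j.2 fun h => hj (Subtype.ext h)
    rw [map_mul, map_mul, SimpleRoots.rep_simple, refl_partRoots,
      CoxeterSystem.lengthParity_simple]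
    rcases hw with ⟨h₁, h₂⟩ | ⟨h₁, h₂⟩
    · right
      rw [h₁, one_mul, mul_assoc]
      exact ⟨rfl, mul_mem h₂ hj'⟩
    · left
      rw [h₁]
      refine ⟨rfl, ?_⟩
      have := mul_mem h₂ (inv_mem hj')
      rwa [mul_inv_rev, inv_eq_of_mul_eq_one_right (SimpleRoots.refl_mul_self _ _),
        inv_eq_of_mul_eq_one_right (SimpleRoots.refl_mul_self _ _), mul_assoc,
        ← mul_assoc ((latRoots (d + 1)).refl _) ((latRoots (d + 1)).refl _),
        SimpleRoots.refl_mul_self, one_mul] at this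
  rw [parabolic] at hw
  induction hw using Subgroup.closure_induction_right with
  | one => exact Or.inl ⟨map_one _, by rw [map_one]; exact one_mem _⟩
  | mul_right w hw s hs ih =>
    obtain ⟨j, hj, rfl⟩ := hs
    exact key w j hj ih
  | mul_inv_cancel w hw s hs ih =>
    obtain ⟨j, hj, rfl⟩ := hs
    rw [CoxeterSystem.inv_simple]
    exact key w j hj ih

/-- An element of the elementary group acting as an even element of `parabolic d` comes from
the previous dimension. -/
lemma mem_subElemGroup_of_mem_pairs {g : UnitMat (d + 1)} (hg : g ∈ elemGroup (d + 1))
    {w : (partRoots d).Weyl} (hw : w ∈ parabolic d) (hw' : (partRoots d).cs.lengthParity w = 1)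
    (h : (g, (partRoots d).rep w) ∈ pairs (d + 1)) : g ∈ subElemGroup d := by
  rcases rep_mem_autSub hw with ⟨-, h'⟩ | ⟨h', -⟩
  · obtain ⟨c, hc, hcw⟩ := mem_autSub.1 h'
    have h₁ : (g * c⁻¹, 1) ∈ pairs (d + 1) := by
      simpa using (pairs (d + 1)).mul_mem h ((pairs (d + 1)).inv_mem hcw)
    have h₂ : g * c⁻¹ ∈ subElemGroup d := by
      rcases eq_one_or_neg_one (mul_mem hg (inv_mem (subElemGroup_le_elemGroup hc))) h₁ with e | e
      · rw [e]; exact one_mem _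
      · rw [e]; exact neg_one_mem_subElemGroup
    simpa using mul_mem h₂ hc
  · rw [hw'] at h'
    exact absurd h' (by decide)

/-- Positivity of the Hermitian matrix `emb p`. -/
def PosDef (p : Lat d) : Prop := 0 < p.2.1 ∧ latForm d p p < 0

lemma posDef_iff {p : Lat d} : PosDef p ↔ 0 < p.2.1 ∧ p.2.2 ⬝ᵥ p.2.2 < p.1 * p.2.1 := by
  rw [PosDef, latForm_apply]
  constructor <;> rintro ⟨h₁, h₂⟩ <;> refine ⟨h₁, ?_⟩ <;> linarith

lemma dotProduct_self_nonneg' {ι : Type*} [Fintype ι] (x : ι → ℤ) : 0 ≤ x ⬝ᵥ x :=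
  Finset.sum_nonneg fun _ _ => mul_self_nonneg _

lemma PosDef.fst_pos {p : Lat d} (hp : PosDef p) : 0 < p.1 := by
  obtain ⟨h₁, h₂⟩ := posDef_iff.1 hp
  have := dotProduct_self_nonneg' p.2.2
  by_contra! hc
  nlinarith

lemma PosDef.refl {p : Lat d} (hp : PosDef p) (j) : PosDef ((latRoots d).refl j p) := by
  refine ⟨?_, ((latRoots d).form_refl j p p).trans_lt hp.2⟩
  rcases j with _ | ⟨_ | _, κ⟩
  · rw [refl_none]; exact hp.fst_pos
  · rw [refl_false]; exact hp.1
  · rw [refl_true]; exact hp.1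

lemma PosDef.rep {p : Lat (d + 1)} (hp : PosDef p) (w : (partRoots d).Weyl) :
    PosDef ((partRoots d).rep w p) := by
  induction w using (partRoots d).cs.simple_induction_left with
  | one => simpa using hp
  | mul_simple_left w i ih =>
    rw [map_mul, LinearEquiv.mul_apply, SimpleRoots.rep_simple]
    exact ih.refl i.1

/-- The last coordinate of a lattice vector. -/
def lastCoord (p : Lat (d + 1)) : ℤ := p.2.2 (some (Fin.last d))

/-- The vector of the linear root of the last coordinate. -/
def lastVec (d : ℕ) : Lat (d + 1) := latRoot (d + 1) (some (true, some (Fin.last d)))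

lemma latForm_lastVec (p : Lat (d + 1)) : latForm (d + 1) (lastVec d) p = 2 * lastCoord p := by
  simp [latForm_apply, lastVec, latRoot, lastCoord]

lemma lastCoord_refl (p : Lat (d + 1)) (j : Option (Bool × Option (Fin (d + 1))))
    (h₁ : j ≠ some (true, some (Fin.last d))) (h₂ : j ≠ some (false, some (Fin.last d))) :
    lastCoord ((latRoots (d + 1)).refl j p) = lastCoord p := by
  rcases j with _ | ⟨_ | _, κ⟩
  · rw [refl_none]; rfl
  · rw [refl_false]
    have : some (Fin.last d) ≠ κ := by rintro rfl; exact h₂ rfl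
    simp [lastCoord, this]
  · rw [refl_true]
    have : some (Fin.last d) ≠ κ := by rintro rfl; exact h₁ rfl
    simp [lastCoord, this]

lemma lastCoord_rep (p : Lat (d + 1)) {w : (partRoots d).Weyl} (hw : w ∈ parabolic d) :
    lastCoord ((partRoots d).rep w p) = lastCoord p := by
  have key (j) (hj : j ≠ bLast d) (p) : lastCoord ((partRoots d).refl j p) = lastCoord p :=
    lastCoord_refl p j.1 j.2 fun h => hj (Subtype.ext h)
  rw [parabolic] at hw
  induction hw using Subgroup.closure_induction_left with
  | one => simp
  | mul_left s hs w hw ih =>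
    obtain ⟨j, hj, rfl⟩ := hs
    rw [map_mul, LinearEquiv.mul_apply, SimpleRoots.rep_simple, key j hj, ih]
  | inv_mul_cancel s hs w hw ih =>
    obtain ⟨j, hj, rfl⟩ := hs
    rw [CoxeterSystem.inv_simple, map_mul, LinearEquiv.mul_apply, SimpleRoots.rep_simple,
      key j hj, ih]

lemma form_root_bLast : (partRoots d).form ((partRoots d).root (bLast d)) (lastVec d) = -2 := by
  change latForm (d + 1) (latRoot (d + 1) (some (false, some (Fin.last d)))) (lastVec d) = -2
  simp [latForm_apply, latRoot, lastVec]

lemma form_root_of_ne (i) (hi : i ≠ bLast d) :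
    (partRoots d).form ((partRoots d).root i) (lastVec d) = 0 := by
  obtain ⟨i, h₁⟩ := i
  have h₂ : i ≠ some (false, some (Fin.last d)) := fun h => hi (Subtype.ext h)
  change latForm (d + 1) (latRoot (d + 1) i) (lastVec d) = 0
  rcases i with _ | ⟨_ | _, κ⟩
  · simp [latForm_apply, latRoot, lastVec]
  · have : some (Fin.last d) ≠ κ := by rintro rfl; exact h₂ rfl
    simp [latForm_apply, latRoot, lastVec, this.symm]
  · have : some (Fin.last d) ≠ κ := by rintro rfl; exact h₁ rfl
    simp [latForm_apply, latRoot, lastVec, this.symm]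

lemma diagonal_of_mem_cone {k : Lat (d + 1)} (hk : k ∈ (partRoots d).cone) :
    k.2.1 ≤ 0 ∧ (k.2.1 = 0 → k.1 ≤ 0) := by
  induction hk using AddSubmonoid.closure_induction with
  | mem x hx =>
    obtain ⟨⟨j, hj⟩, rfl⟩ := hx
    change (latRoot (d + 1) j).2.1 ≤ 0 ∧ ((latRoot (d + 1) j).2.1 = 0 → (latRoot (d + 1) j).1 ≤ 0)
    rcases j with _ | ⟨_ | _, κ⟩ <;> simp [latRoot]
  | zero => simp
  | add x y _ _ hx hy =>
    simp only [Prod.fst_add, Prod.snd_add]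
    omega

lemma dotProduct_sq_le {ι : Type*} [Fintype ι] (x y : ι → ℤ) :
    (x ⬝ᵥ y) ^ 2 ≤ (x ⬝ᵥ x) * (y ⬝ᵥ y) := by
  simpa [dotProduct, sq] using Finset.sum_mul_sq_le_sq_mul_sq Finset.univ x y

lemma form_nonneg {h p : Lat d} (hp : PosDef p) (hh : latForm d h h ≤ 0)
    (h₁ : h.2.1 ≤ 0) (h₂ : h.2.1 = 0 → h.1 ≤ 0) : 0 ≤ latForm d h p := by
  obtain ⟨r, t, x⟩ := h
  have hr := hp.fst_pos
  obtain ⟨ht', hp'⟩ := posDef_iff.1 hp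
  obtain ⟨r', t', x'⟩ := p
  simp only [latForm_apply] at *
  have hx := dotProduct_self_nonneg' x
  have hx' := dotProduct_self_nonneg' x'
  have hcs := dotProduct_sq_le x x'
  have hr0 : r ≤ 0 := by
    rcases h₁.lt_or_eq with h | h
    · by_contra! hc
      nlinarith
    · exact h₂ h
  generalize x ⬝ᵥ x = a at *
  generalize x' ⬝ᵥ x' = b at *
  generalize x ⬝ᵥ x' = c at *
  have ha : a ≤ r * t := by linarith
  have h3 : c ^ 2 ≤ (r * t) * (r' * t') := hcs.trans (mul_le_mul ha hp'.le hx' (hx.trans ha))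
  have h4 : (2 * c) ^ 2 ≤ (-(r * t') - t * r') ^ 2 := by nlinarith [sq_nonneg (r * t' - t * r')]
  have h5 : 0 ≤ -(r * t') - t * r' := by nlinarith
  have := abs_le_of_sq_le_sq' h4 h5
  linarith [this.1]

/-- The main estimate: the images under the Weyl group of the last root are positive or negative
on the positive cone like the root itself. -/
lemma form_rep_lastVec_pos {p : Lat (d + 1)} (hp : PosDef p) (hl : lastCoord p < 0)
    {w : (partRoots d).Weyl} (hw : w ∉ parabolic d) :
    0 < latForm (d + 1) ((partRoots d).rep w (lastVec d)) p := by
  obtain ⟨k, hk, hwk, -, h | h⟩ := (partRoots d).rep_eq_add_two_smul (lastVec d) (bLast d)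
    form_root_bLast form_root_of_ne w
  · exact absurd h hw
  · have hform := (partRoots d).form_rep w (lastVec d) (lastVec d)
    change latForm (d + 1) _ _ = latForm (d + 1) _ _ at hform
    change latForm (d + 1) _ _ ≤ -2 at h
    have hsymm : latForm (d + 1) k (lastVec d) = latForm (d + 1) (lastVec d) k :=
      (latRoots (d + 1)).symm _ _
    have hvv : latForm (d + 1) (lastVec d) (lastVec d) = 2 := (latRoots (d + 1)).root_self _
    rw [hwk] at hform ⊢
    simp only [map_add, map_smul, LinearMap.add_apply, LinearMap.smul_apply, smul_eq_mul] at hform ⊢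
    have hh : latForm (d + 1) (lastVec d + k) (lastVec d + k) ≤ 0 := by
      simp only [map_add, LinearMap.add_apply]
      linarith
    obtain ⟨h₁, h₂⟩ := diagonal_of_mem_cone hk
    have := form_nonneg hp hh (by simpa [lastVec, latRoot] using h₁)
      (by simpa [lastVec, latRoot] using h₂)
    rw [map_add, LinearMap.add_apply] at this
    have hv := latForm_lastVec p
    linarith

/-- A base point on the positive side of all the walls. -/
def basePoint (d : ℕ) : Lat (d + 1) := (2, 2, Pi.single (some (Fin.last d)) 1)

lemma posDef_basePoint : PosDef (basePoint d) := by
  simp [posDef_iff, basePoint]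

lemma form_cone_basePoint_nonneg {k : Lat (d + 1)} (hk : k ∈ (partRoots d).cone) :
    0 ≤ latForm (d + 1) k (basePoint d) := by
  induction hk using AddSubmonoid.closure_induction with
  | mem x hx =>
    obtain ⟨⟨j, hj⟩, rfl⟩ := hx
    change 0 ≤ latForm (d + 1) (latRoot (d + 1) j) _
    rcases j with _ | ⟨_ | _, κ⟩
    · simp [latForm_apply, latRoot, basePoint]
    · rcases eq_or_ne (some (Fin.last d)) κ with h | h
      · simp [latForm_apply, latRoot, basePoint, h]
      · simp [latForm_apply, latRoot, basePoint, h.symm]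
    · have : some (Fin.last d) ≠ κ := by rintro rfl; exact hj rfl
      simp [latForm_apply, latRoot, basePoint, this.symm]
  | zero => simp
  | add x y _ _ hx hy =>
    rw [map_add, LinearMap.add_apply]
    exact add_nonneg hx hy

lemma form_rep_lastVec_basePoint_pos (w : (partRoots d).Weyl) :
    0 < latForm (d + 1) ((partRoots d).rep w (lastVec d)) (basePoint d) := by
  obtain ⟨k, hk, hwk, -⟩ := (partRoots d).rep_eq_add_two_smul (lastVec d) (bLast d)
    form_root_bLast form_root_of_ne w
  have h₁ := form_cone_basePoint_nonneg hk
  have h₂ : lastCoord (basePoint d) = 1 := by simp [lastCoord, basePoint]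
  rw [hwk, map_add, map_smul, LinearMap.add_apply, LinearMap.smul_apply, smul_eq_mul,
    latForm_lastVec, h₂]
  linarith

lemma lastCoord_rep_inv (w : (partRoots d).Weyl) (p : Lat (d + 1)) :
    2 * lastCoord ((partRoots d).rep w⁻¹ p) =
      latForm (d + 1) ((partRoots d).rep w (lastVec d)) p := by
  rw [← latForm_lastVec]
  have := (partRoots d).form_rep w (lastVec d) ((partRoots d).rep w⁻¹ p)
  rw [← LinearEquiv.mul_apply, ← map_mul, mul_inv_cancel, map_one, LinearEquiv.coe_one, id] at this
  exact this.symm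

/-- The `2 × 2` matrices over `StdCl d`, with the action of the invertible ones by
`g • x = g * x * star g`. -/
def CongMat (d : ℕ) : Type := Matrix (Fin 2) (Fin 2) (StdCl d)

/-- The congruence action of a single matrix. -/
def cong (g x : Matrix (Fin 2) (Fin 2) (StdCl d)) : Matrix (Fin 2) (Fin 2) (StdCl d) :=
  g * x * star g

lemma cong_one (x : Matrix (Fin 2) (Fin 2) (StdCl d)) : cong 1 x = x := by
  rw [cong, star_one, one_mul, mul_one]

lemma cong_mul (g h x : Matrix (Fin 2) (Fin 2) (StdCl d)) :
    cong (g * h) x = cong g (cong h x) := by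
  simp only [cong, star_mul, mul_assoc]

instance : MulAction (UnitMat d) (CongMat d) where
  smul g x := cong (g : Matrix (Fin 2) (Fin 2) (StdCl d)) x
  one_smul := cong_one
  mul_smul g h := cong_mul (g : Matrix (Fin 2) (Fin 2) (StdCl d)) h

/-- The point of `CongMat d` given by a lattice vector. -/
def congPoint (p : Lat d) : CongMat d := emb p

lemma smul_congPoint {g : UnitMat d} {T : Lat d ≃ₗ[ℤ] Lat d} (h : (g, T) ∈ pairs d) (p : Lat d) :
    g • congPoint p = congPoint (T p) := (mem_pairs.1 h p).symm

/-- The positive definite matrices with positive last coordinate. -/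
def posSet (d : ℕ) : Set (CongMat (d + 1)) := congPoint '' {p | PosDef p ∧ 0 < lastCoord p}

/-- The positive definite matrices with negative last coordinate. -/
def negSet (d : ℕ) : Set (CongMat (d + 1)) := congPoint '' {p | PosDef p ∧ lastCoord p < 0}

lemma congPoint_mem_posSet {p : Lat (d + 1)} :
    congPoint p ∈ posSet d ↔ PosDef p ∧ 0 < lastCoord p :=
  Function.Injective.mem_set_image (f := congPoint) emb_injective

lemma disjoint_posSet_negSet : Disjoint (posSet d) (negSet d) := by
  rw [Set.disjoint_right]
  rintro _ ⟨p, hp, rfl⟩ h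
  exact lt_asymm (congPoint_mem_posSet.1 h).2 hp.2

lemma smul_mem_posSet_of_mem_subElemGroup {c : UnitMat (d + 1)} (hc : c ∈ subElemGroup d)
    {x : CongMat (d + 1)} (hx : x ∈ posSet d) : c • x ∈ posSet d := by
  obtain ⟨w, hw, -, h⟩ := subElemGroup_le_evenLifts hc
  obtain ⟨p, hp, rfl⟩ := hx
  exact ⟨_, ⟨hp.1.rep w, (lastCoord_rep p hw).symm ▸ hp.2⟩, (smul_congPoint h p).symm⟩

lemma smul_mem_negSet_of_mem_subElemGroup {c : UnitMat (d + 1)} (hc : c ∈ subElemGroup d)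
    {x : CongMat (d + 1)} (hx : x ∈ negSet d) : c • x ∈ negSet d := by
  obtain ⟨w, hw, -, h⟩ := subElemGroup_le_evenLifts hc
  obtain ⟨p, hp, rfl⟩ := hx
  exact ⟨_, ⟨hp.1.rep w, (lastCoord_rep p hw).symm ▸ hp.2⟩, (smul_congPoint h p).symm⟩

lemma diagLast_smul_mem_negSet {x : CongMat (d + 1)} (hx : x ∈ posSet d) :
    diagLast d • x ∈ negSet d := by
  obtain ⟨p, hp, rfl⟩ := hx
  refine ⟨_, ⟨(hp.1.refl (some (true, none))).refl (some (true, some (Fin.last d))), ?_⟩,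
    (smul_congPoint (diagUnit_mem_pairs (Fin.last d)) p).symm⟩
  have := hp.2
  simp only [lastCoord] at this
  simp [refl_true, lastCoord]
  linarith

lemma diagLast_mul_vec {x : Option (Fin (d + 1)) → ℤ} (hx : x (some (Fin.last d)) = 0) :
    ι (stdForm (d + 1)) (Pi.single (Fin.last d) 1) * vec (d + 1) x =
      - vec (d + 1) (fun κ => κ.elim (-x none) fun k => x (some k)) *
        ι (stdForm (d + 1)) (Pi.single (Fin.last d) 1) := by
  have h : ι (stdForm (d + 1)) (Pi.single (Fin.last d) 1) * ι (stdForm (d + 1)) (x ∘ some) =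
      -(ι (stdForm (d + 1)) (x ∘ some) * ι (stdForm (d + 1)) (Pi.single (Fin.last d) 1)) := by
    rw [eq_neg_iff_add_eq_zero, ι_mul_ι_add]
    simp [hx]
  rw [vec_apply, vec_apply, mul_add, h, neg_add, add_mul, neg_mul, neg_mul,
    ← Algebra.commutes]
  simp [Function.comp_def]

lemma diagLast_conj_mem {c : UnitMat (d + 1)} (hc : c ∈ subElemGroup d) :
    diagLast d * c * (diagLast d)⁻¹ ∈ subElemGroup d := by
  have : subElemGroup d ≤ (subElemGroup d).comap (MulAut.conj (diagLast d)).toMonoidHom := by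
    nth_rw 1 [subElemGroup]
    rw [Subgroup.closure_le]
    rintro _ ⟨x, hx, rfl⟩
    change diagLast d * _ * (diagLast d)⁻¹ ∈ subElemGroup d
    rw [diagLast, diagUnit_mul_elemUnit _ _ (diagLast_mul_vec hx)]
    exact mul_mem neg_one_mem_subElemGroup (elemUnit_mem_subElemGroup hx)
  exact this hc

lemma diagLast_mul_self : diagLast d * diagLast d = -1 := diagUnit_mul_self _ _

lemma mem_or_mul_mem_of_mem_vertexA {a : UnitMat (d + 1)} (ha : a ∈ vertexA d) :
    a ∈ subElemGroup d ∨ a * diagLast d ∈ subElemGroup d := by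
  have key : ∀ y : UnitMat (d + 1), (y ∈ subElemGroup d ∨ y * diagLast d ∈ subElemGroup d) →
      (diagLast d * y ∈ subElemGroup d ∨ diagLast d * y * diagLast d ∈ subElemGroup d) := by
    have h₁ : diagLast d = (diagLast d)⁻¹ * -1 := by
      rw [eq_inv_mul_iff_mul_eq, diagLast_mul_self]
    rintro y (hy | hy)
    · right
      have := mul_mem (diagLast_conj_mem hy) neg_one_mem_subElemGroup
      rwa [mul_assoc, ← h₁] at this
    · left
      have := diagLast_conj_mem hy
      rwa [mul_assoc, mul_assoc, mul_inv_cancel, mul_one] at this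
  rw [vertexA] at ha
  induction ha using Subgroup.closure_induction_left with
  | one => exact Or.inl (one_mem _)
  | mul_left s hs y hy ih =>
    rcases hs with rfl | hs
    · exact key y ih
    · rw [mul_assoc]
      exact ih.imp (mul_mem hs) (mul_mem hs)
  | inv_mul_cancel s hs y hy ih =>
    rcases hs with rfl | hs
    · have h₁ : (diagLast d)⁻¹ = -1 * diagLast d := by
        rw [inv_eq_iff_mul_eq_one, neg_one_mul, mul_neg, diagLast_mul_self, neg_neg]
      rw [h₁, mul_assoc, mul_assoc]
      exact (key y ih).imp (mul_mem neg_one_mem_subElemGroup) fun h =>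
        mul_mem neg_one_mem_subElemGroup h
    · rw [mul_assoc]
      exact ih.imp (mul_mem (inv_mem hs)) (mul_mem (inv_mem hs))

lemma smul_mem_negSet {a : UnitMat (d + 1)} (ha : a ∈ vertexA d) (ha' : a ∉ subElemGroup d)
    {x : CongMat (d + 1)} (hx : x ∈ posSet d) : a • x ∈ negSet d := by
  have h := inv_mem <| (mem_or_mul_mem_of_mem_vertexA (inv_mem ha)).resolve_left fun h =>
    ha' (by simpa using inv_mem h)
  have := diagLast_smul_mem_negSet (smul_mem_posSet_of_mem_subElemGroup h hx)
  rwa [← mul_smul, mul_inv_rev, inv_inv, mul_inv_cancel_left] at this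

lemma subElemGroup_le_vertexA : subElemGroup d ≤ vertexA d :=
  (Set.subset_insert _ _).trans Subgroup.subset_closure

lemma subElemGroup_le_vertexB : subElemGroup d ≤ vertexB d :=
  (Set.subset_insert _ _).trans Subgroup.subset_closure

lemma diagLast_mem_vertexA : diagLast d ∈ vertexA d :=
  Subgroup.subset_closure (Set.mem_insert _ _)

lemma upperLast_mul_diagLast_mem_vertexB : upperLast d * diagLast d ∈ vertexB d :=
  Subgroup.subset_closure (Set.mem_insert _ _)

lemma vertexA_le_elemGroup : vertexA d ≤ elemGroup (d + 1) := by
  rw [vertexA, Subgroup.closure_le, Set.insert_subset_iff]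
  exact ⟨diagUnit_mem_elemGroup _, subElemGroup_le_elemGroup⟩

lemma vertexB_le_elemGroup : vertexB d ≤ elemGroup (d + 1) := by
  rw [vertexB, Subgroup.closure_le, Set.insert_subset_iff]
  exact ⟨mul_mem (upperUnit_mem_elemGroup _) (diagUnit_mem_elemGroup _), subElemGroup_le_elemGroup⟩

lemma elemGroup_le_vertexA_sup_vertexB : elemGroup (d + 1) ≤ vertexA d ⊔ vertexB d := by
  rw [elemGroup, Subgroup.closure_le]
  rintro _ ⟨x, rfl⟩
  have hC : subElemGroup d ≤ vertexA d ⊔ vertexB d := subElemGroup_le_vertexA.trans le_sup_left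
  refine elemUnit_vec_mem (hC elemUnit_zero_mem_subElemGroup) fun κ _ => ?_
  rcases eq_or_ne κ (some (Fin.last d)) with rfl | hκ
  · have := mul_mem ((le_sup_right : _ ≤ vertexA d ⊔ vertexB d) upperLast_mul_diagLast_mem_vertexB)
      (inv_mem ((le_sup_left : _ ≤ vertexA d ⊔ vertexB d) diagLast_mem_vertexA))
    rwa [mul_inv_cancel_right] at this
  · exact hC (upperUnit_mem_subElemGroup (by simp [hκ.symm]))

lemma exists_rep_inv {b : UnitMat (d + 1)} (hb : b ∈ vertexB d) :
    ∃ w, (w ∈ parabolic d → b ∈ subElemGroup d) ∧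
      (b, (partRoots d).rep w⁻¹) ∈ pairs (d + 1) := by
  obtain ⟨w, -, hw, h⟩ := vertexB_le_evenLifts (inv_mem hb)
  refine ⟨w, fun hw' => ?_, ?_⟩
  · simpa using inv_mem
      (mem_subElemGroup_of_mem_pairs (vertexB_le_elemGroup (inv_mem hb)) hw' hw h)
  · have := (pairs (d + 1)).inv_mem h
    rwa [Prod.inv_mk, inv_inv, ← map_inv] at this

lemma smul_mem_posSet {b : UnitMat (d + 1)} (hb : b ∈ vertexB d) (hb' : b ∉ subElemGroup d)
    {x : CongMat (d + 1)} (hx : x ∈ negSet d) : b • x ∈ posSet d := by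
  obtain ⟨w, hw, h⟩ := exists_rep_inv hb
  obtain ⟨p, hp, rfl⟩ := hx
  have := form_rep_lastVec_pos hp.1 hp.2 fun h => hb' (hw h)
  rw [← lastCoord_rep_inv] at this
  exact ⟨_, ⟨hp.1.rep _, by linarith⟩, (smul_congPoint h p).symm⟩

lemma smul_basePoint_mem_posSet {b : UnitMat (d + 1)} (hb : b ∈ vertexB d) :
    b • congPoint (basePoint d) ∈ posSet d := by
  obtain ⟨w, -, h⟩ := exists_rep_inv hb
  have := form_rep_lastVec_basePoint_pos w
  rw [← lastCoord_rep_inv] at this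
  exact ⟨_, ⟨posDef_basePoint.rep _, by linarith⟩, (smul_congPoint h _).symm⟩

lemma diagLast_notMem_subElemGroup : diagLast d ∉ subElemGroup d := fun h => by
  have hp : congPoint (basePoint d) ∈ posSet d := by
    simpa using smul_basePoint_mem_posSet (one_mem (vertexB d))
  exact Set.disjoint_left.1 disjoint_posSet_negSet (smul_mem_posSet_of_mem_subElemGroup h hp)
    (diagLast_smul_mem_negSet hp)

lemma upperLast_mul_diagLast_notMem_subElemGroup :
    upperLast d * diagLast d ∉ subElemGroup d := fun h => by
  let p : Lat (d + 1) := (2, 1, Pi.single (some (Fin.last d)) 1)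
  have hp : congPoint p ∈ posSet d :=
    congPoint_mem_posSet.2 ⟨by simp [posDef_iff, p], by simp [lastCoord, p]⟩
  have h₁ := smul_mem_posSet_of_mem_subElemGroup h hp
  rw [smul_congPoint upperLast_mul_diagLast_mem_pairs, congPoint_mem_posSet] at h₁
  have := h₁.2
  simp [lastCoord, refl_true, refl_false, p] at this

/-- The two vertex groups. -/
def vertex (d : ℕ) (b : Bool) : Subgroup (UnitMat (d + 1)) := cond b (vertexA d) (vertexB d)

lemma subElemGroup_le_vertex (b : Bool) : subElemGroup d ≤ vertex d b := by
  cases b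
  · exact subElemGroup_le_vertexB
  · exact subElemGroup_le_vertexA

/-- The inclusion of the elementary group of the previous dimension. -/
def inclElem (d : ℕ) : elemGroup d →* UnitMat (d + 1) :=
  (Units.map (incl d).mapMatrix.toMonoidHom).comp (elemGroup d).subtype

lemma range_inclElem : (inclElem d).range = subElemGroup d := by
  rw [inclElem, MonoidHom.range_comp, Subgroup.range_subtype, subElemGroup_eq_map]

lemma inclElem_injective : Function.Injective (inclElem d) :=
  (Units.map_injective (Matrix.map_injective incl_injective)).comp Subtype.coe_injective

/-- The inclusions of the elementary group of the previous dimension in the vertex groups. -/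
def inclVertex (d : ℕ) (b : Bool) : elemGroup d →* vertex d b :=
  (inclElem d).codRestrict (vertex d b) fun c =>
    subElemGroup_le_vertex b (range_inclElem (d := d) ▸ ⟨c, rfl⟩)

lemma inclVertex_injective (b : Bool) : Function.Injective (inclVertex d b) :=
  fun _ _ h => inclElem_injective (congrArg Subtype.val h)

lemma mem_range_inclVertex {b : Bool} (g : vertex d b) :
    g ∈ (inclVertex d b).range ↔ (g : UnitMat (d + 1)) ∈ subElemGroup d := by
  rw [← range_inclElem]
  exact ⟨fun ⟨c, hc⟩ => ⟨c, congrArg Subtype.val hc⟩, fun ⟨c, hc⟩ => ⟨c, Subtype.ext hc⟩⟩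

lemma inclVertex_not_surjective (b : Bool) : ¬ Function.Surjective (inclVertex d b) := by
  intro h
  cases b
  · exact upperLast_mul_diagLast_notMem_subElemGroup
      ((mem_range_inclVertex (b := false) ⟨_, upperLast_mul_diagLast_mem_vertexB⟩).1 (h _))
  · exact diagLast_notMem_subElemGroup
      ((mem_range_inclVertex (b := true) ⟨_, diagLast_mem_vertexA⟩).1 (h _))

lemma subtype_comp_inclVertex (b : Bool) :
    (vertex d b).subtype.comp (inclVertex d b) = inclElem d := rfl

/-- The canonical homomorphism from the amalgamated product of the vertex groups. -/
def amalgamLift (d : ℕ) : Monoid.PushoutI (inclVertex d) →* UnitMat (d + 1) :=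
  Monoid.PushoutI.lift (fun b => (vertex d b).subtype) (inclElem d)
    subtype_comp_inclVertex

lemma amalgamLift_injective : Function.Injective (amalgamLift d) :=
  have mem (c) : inclElem d c ∈ subElemGroup d := range_inclElem (d := d) ▸ ⟨c, rfl⟩
  Monoid.PushoutI.lift_injective_of_ping_pong inclVertex_injective _ inclElem_injective
    disjoint_posSet_negSet (fun c _ => smul_mem_posSet_of_mem_subElemGroup (mem c))
    (fun c _ => smul_mem_negSet_of_mem_subElemGroup (mem c))
    (fun a ha _ => smul_mem_negSet a.2 fun h => ha ((mem_range_inclVertex a).2 h))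
    (fun b hb _ => smul_mem_posSet b.2 fun h => hb ((mem_range_inclVertex b).2 h))
    (fun b => smul_basePoint_mem_posSet b.2) (inclVertex_not_surjective true)

lemma range_amalgamLift : (amalgamLift d).range = elemGroup (d + 1) := by
  apply le_antisymm
  · rintro _ ⟨x, rfl⟩
    induction x using Monoid.PushoutI.induction_on with
    | of b g =>
      rw [amalgamLift, Monoid.PushoutI.lift_of]
      cases b
      · exact vertexB_le_elemGroup g.2
      · exact vertexA_le_elemGroup g.2
    | base c =>
      rw [amalgamLift, Monoid.PushoutI.lift_base]
      exact subElemGroup_le_elemGroup (range_inclElem (d := d) ▸ ⟨c, rfl⟩)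
    | mul x y hx hy =>
      rw [map_mul]
      exact mul_mem hx hy
  · refine elemGroup_le_vertexA_sup_vertexB.trans (sup_le (fun g hg => ?_) fun g hg => ?_)
    · exact ⟨Monoid.PushoutI.of true ⟨g, hg⟩, Monoid.PushoutI.lift_of ..⟩
    · exact ⟨Monoid.PushoutI.of false ⟨g, hg⟩, Monoid.PushoutI.lift_of ..⟩

/-- The elementary group as an amalgamated product over the one of the previous dimension. -/
def elemGroupEquiv (d : ℕ) : elemGroup (d + 1) ≃* Monoid.PushoutI (inclVertex d) :=
  ((MonoidHom.ofInjective amalgamLift_injective).trans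
    (MulEquiv.subgroupCongr range_amalgamLift)).symm

end StdCl

lemma StdCl.range_vec (d : ℕ) : LinearMap.range (vec d) = Submodule.span ℤ
    (insert 1 (Set.range fun k => ι (stdForm d) (Pi.single k 1))) := by
  apply le_antisymm
  · rintro _ ⟨x, rfl⟩
    have : x = ∑ κ, x κ • (Pi.single κ 1 : Option (Fin d) → ℤ) := by
      ext κ
      simp [Finset.sum_apply, Pi.single_apply]
    rw [this, map_sum]
    refine Submodule.sum_mem _ fun κ _ => ?_
    rw [map_smul]
    refine Submodule.smul_mem _ _ (Submodule.subset_span ?_)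
    rcases κ with _ | k
    · exact Or.inl vec_single_none
    · exact Or.inr ⟨k, (vec_single_some k).symm⟩
  · rw [Submodule.span_le, Set.insert_subset_iff]
    refine ⟨⟨_, vec_single_none⟩, ?_⟩
    rintro _ ⟨k, rfl⟩
    exact ⟨_, vec_single_some k⟩

lemma mem_Vn_iff {d : ℕ} {x : StdCl d} : x ∈ Vn (d + 1) ↔ ∃ y, StdCl.vec d y = x := by
  have : x ∈ Vn (d + 1) ↔ x ∈ LinearMap.range (StdCl.vec d) := by
    rw [StdCl.range_vec]
    rfl
  exact this

lemma E2Gamma_eq_elemGroup (d : ℕ) : E2Gamma (d + 1) = StdCl.elemGroup d := by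
  refine congrArg Subgroup.closure (Set.ext fun g => ⟨?_, ?_⟩)
  · rintro ⟨x, hx, rfl⟩
    obtain ⟨y, rfl⟩ := mem_Vn_iff.1 hx
    exact ⟨y, rfl⟩
  · rintro ⟨y, rfl⟩
    exact ⟨StdCl.vec d y, mem_Vn_iff.2 ⟨y, rfl⟩, rfl⟩

/-- For every `n ≥ 2`, `E₂(Γ_n(ℤ))` is a nontrivial amalgamated product with amalgamated
subgroup `E₂(Γ_{n-1}(ℤ))`. -/
theorem E2Gamma_amalgam_over_pred (n : ℕ) (hn : 2 ≤ n) :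
    ∃ (Gf : Bool → Type) (_ : ∀ b, Group (Gf b))
      (φ : ∀ b, ↥(E2Gamma (n - 1)) →* Gf b),
        (∀ b, Function.Injective (φ b)) ∧ (∀ b, ¬ Function.Surjective (φ b)) ∧
        Nonempty (↥(E2Gamma n) ≃* Monoid.PushoutI φ) := by
  obtain ⟨d, rfl⟩ : ∃ d, n = d + 2 := ⟨n - 2, by omega⟩
  change ∃ (Gf : Bool → Type) (_ : ∀ b, Group (Gf b))
      (φ : ∀ b, ↥(E2Gamma (d + 1)) →* Gf b),
        (∀ b, Function.Injective (φ b)) ∧ (∀ b, ¬ Function.Surjective (φ b)) ∧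
        Nonempty (↥(E2Gamma (d + 1 + 1)) ≃* Monoid.PushoutI φ)
  rw [E2Gamma_eq_elemGroup, E2Gamma_eq_elemGroup]
  exact ⟨fun b => StdCl.vertex d b, fun _ => inferInstance, StdCl.inclVertex d,
    StdCl.inclVertex_injective, StdCl.inclVertex_not_surjective, ⟨StdCl.elemGroupEquiv d⟩⟩
end
end

section
/- For every n ≥ 2, the abelianization of E₂(Γ_n(ℤ)) is elementary abelian of order 2ⁿ, i.e. it is isomorphic to the direct product of n copies of the cyclic group of order 2. -/
noncomputable section

open CliffordAlgebra

section Relations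

lemma one_mem_Vn (n : ℕ) : (1 : Cl n) ∈ Vn n :=
  Submodule.subset_span (Set.mem_insert _ _)

lemma iGen_mem_Vn (n : ℕ) (h : Fin (n - 1)) : iGen n h ∈ Vn n :=
  Submodule.subset_span (Set.mem_insert_of_mem _ ⟨h, rfl⟩)

lemma map_Vn_mem {n : ℕ} {A : Type*} [AddCommGroup A] (f : Vn n →+ A) (S : AddSubgroup A)
    (h1 : f ⟨1, one_mem_Vn n⟩ ∈ S) (hi : ∀ h, f ⟨iGen n h, iGen_mem_Vn n h⟩ ∈ S) (x : Vn n) :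
    f x ∈ S := by
  obtain ⟨x, hx⟩ := x
  induction hx using Submodule.span_induction with
  | mem x hx =>
    rcases hx with rfl | ⟨h, rfl⟩
    exacts [h1, hi h]
  | zero => exact (map_zero f).symm ▸ zero_mem S
  | add x y hx hy ihx ihy => exact (map_add f ⟨x, hx⟩ ⟨y, hy⟩).symm ▸ add_mem ihx ihy
  | smul a x hx ih => exact (map_zsmul f a ⟨x, hx⟩).symm ▸ zsmul_mem ih a

/-- `E(x)` as an element of `E₂(Γ_n(ℤ))`. -/
def elem (n : ℕ) (x : Vn n) : E2Gamma n :=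
  ⟨Eu n x, Subgroup.subset_closure ⟨x, x.2, rfl⟩⟩

lemma elem_mul_inv_mul (n : ℕ) (x y : Vn n) :
    elem n x * (elem n 0)⁻¹ * elem n y = elem n (x + y) := by
  ext i j
  fin_cases i <;> fin_cases j <;> simp [elem, Eu, add_comm]

lemma elem_zero_pow (n : ℕ) : elem n 0 ^ 4 = 1 := by
  ext i j
  fin_cases i <;> fin_cases j <;> simp [elem, Eu, pow_succ]

lemma elem_neg_one_pow (n : ℕ) : elem n (-⟨1, one_mem_Vn n⟩) ^ 3 = 1 := by
  ext i j
  fin_cases i <;> fin_cases j <;> simp [elem, Eu, pow_succ]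

/-- Conjugating a transvection `E(x)E(0)⁻¹` by `E(u)E(-u)E(u) = -diag(u, u⁻¹)`, where `u² = -1`
and `u` commutes with `x`, inverts it. -/
lemma elem_conj (n : ℕ) (u x : Vn n) (hu : (u : Cl n) * u = -1)
    (hx : (x : Cl n) * u = u * x) :
    elem n x * (elem n 0)⁻¹ * (elem n u * elem n (-u) * elem n u) =
      elem n u * elem n (-u) * elem n u * (elem n (-x) * (elem n 0)⁻¹) := by
  ext i j
  fin_cases i <;> fin_cases j <;> simp [elem, Eu, hu, hx]

end Relations

section Abelianization

/-- The class of the transvection `E(x)E(0)⁻¹` in the abelianization, additively in `x`. -/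
def transv (n : ℕ) : Vn n →+ Additive (Abelianization (E2Gamma n)) :=
  AddMonoidHom.mk'
    (fun x => Additive.ofMul (Abelianization.of (elem n x)) -
      Additive.ofMul (Abelianization.of (elem n 0)))
    (fun x y => by
      rw [← elem_mul_inv_mul]
      simp only [map_mul, map_inv, ofMul_mul, ofMul_inv]
      abel)

lemma ofMul_of_elem (n : ℕ) (x : Vn n) :
    Additive.ofMul (Abelianization.of (elem n x)) =
      transv n x + Additive.ofMul (Abelianization.of (elem n 0)) := by
  simp [transv]

lemma two_nsmul_transv_of_commute (n : ℕ) (u x : Vn n) (hu : (u : Cl n) * u = -1)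
    (hx : (x : Cl n) * u = u * x) : 2 • transv n x = 0 := by
  have h := congrArg (fun g => Additive.ofMul (Abelianization.of g)) (elem_conj n u x hu hx)
  simp only [map_mul, map_inv, ofMul_mul, ofMul_inv, ofMul_of_elem n u, ofMul_of_elem n x,
    ofMul_of_elem n (-u), ofMul_of_elem n (-x), map_neg] at h
  rw [two_nsmul]
  have h' := sub_eq_zero.2 h
  rw [← h']
  abel

lemma two_nsmul_transv (n : ℕ) (hn : 2 ≤ n) (x : Vn n) : 2 • transv n x = 0 := by
  refine map_Vn_mem (transv n) (nsmulAddMonoidHom 2).ker ?_ (fun h => ?_) x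
  · exact two_nsmul_transv_of_commute n ⟨_, iGen_mem_Vn n ⟨0, by omega⟩⟩ ⟨1, one_mem_Vn n⟩
      (iGen_sq n _) (by simp)
  · exact two_nsmul_transv_of_commute n ⟨_, iGen_mem_Vn n h⟩ ⟨_, iGen_mem_Vn n h⟩ (iGen_sq n _) rfl

lemma ofMul_of_elem_zero (n : ℕ) (hn : 2 ≤ n) :
    Additive.ofMul (Abelianization.of (elem n 0)) = transv n ⟨1, one_mem_Vn n⟩ := by
  have h4 := congrArg (fun g => Additive.ofMul (Abelianization.of g)) (elem_zero_pow n)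
  have h3 := congrArg (fun g => Additive.ofMul (Abelianization.of g)) (elem_neg_one_pow n)
  have h2 := two_nsmul_transv n hn ⟨1, one_mem_Vn n⟩
  simp only [map_pow, map_one, ofMul_pow, ofMul_one] at h3 h4
  rw [ofMul_of_elem, map_neg] at h3
  generalize Additive.ofMul (Abelianization.of (elem n 0)) = w at *
  generalize transv n ⟨1, one_mem_Vn n⟩ = t at *
  have : w = 4 • w - 3 • (-t + w) - 2 • (2 • t) + t := by abel
  rw [this, h2, h3, h4]
  simp

lemma transv_surjective (n : ℕ) (hn : 2 ≤ n) : Function.Surjective (transv n) := by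
  suffices h : ∀ g (hg : g ∈ E2Gamma n),
      Additive.ofMul (Abelianization.of (⟨g, hg⟩ : E2Gamma n)) ∈ (transv n).range by
    intro y
    obtain ⟨g, hg⟩ := QuotientGroup.mk'_surjective (commutator (E2Gamma n)) (Additive.toMul y)
    obtain ⟨x, hx⟩ := h g.1 g.2
    exact ⟨x, hx.trans (congrArg Additive.ofMul hg)⟩
  intro g hg
  induction hg using Subgroup.closure_induction with
  | mem g hg =>
    obtain ⟨x, hx, rfl⟩ := hg
    have : Additive.ofMul (Abelianization.of (elem n ⟨x, hx⟩)) ∈ (transv n).range := by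
      rw [ofMul_of_elem, ofMul_of_elem_zero n hn]
      exact add_mem ⟨_, rfl⟩ ⟨_, rfl⟩
    exact this
  | one => exact zero_mem _
  | mul x y hx hy ihx ihy => exact add_mem ihx ihy
  | inv x hx ih => exact neg_mem ih

/-- The family of classes of transvections at `1, i_1, …, i_{n-1}`. -/
def transvGen (n : ℕ) : Option (Fin (n - 1)) → Additive (Abelianization (E2Gamma n))
  | none => transv n ⟨1, one_mem_Vn n⟩
  | some h => transv n ⟨iGen n h, iGen_mem_Vn n h⟩

lemma span_transvGen (n : ℕ) (hn : 2 ≤ n)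
    [Module (ZMod 2) (Additive (Abelianization (E2Gamma n)))] :
    ⊤ ≤ Submodule.span (ZMod 2) (Set.range (transvGen n)) := by
  rintro y -
  obtain ⟨x, rfl⟩ := transv_surjective n hn y
  exact map_Vn_mem (transv n) (Submodule.span (ZMod 2) (Set.range (transvGen n))).toAddSubgroup
    (Submodule.subset_span ⟨none, rfl⟩) (fun h => Submodule.subset_span ⟨some h, rfl⟩) x

end Abelianization

section Characters

open Matrix

/-- The reduction of `E₂(Γ_n(ℤ))` to `SL₂(B)` along a ring homomorphism to a commutative ring. -/
def reduction {B : Type*} [CommRing B] (n : ℕ) (φ : Cl n →+* B) :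
    E2Gamma n →* SpecialLinearGroup (Fin 2) B where
  toFun g := ⟨φ.mapMatrix (g : (Matrix (Fin 2) (Fin 2) (Cl n))ˣ), by
    obtain ⟨g, hg⟩ := g
    induction hg using Subgroup.closure_induction with
    | mem g hg =>
      obtain ⟨x, hx, rfl⟩ := hg
      simp [Eu, det_fin_two]
    | one => simp
    | mul x y hx hy ihx ihy =>
      simp only [Units.val_mul, map_mul, det_mul] at *
      rw [ihx, ihy, one_mul]
    | inv x hx ih =>
      have h := congrArg (fun M => (φ.mapMatrix M).det) x.mul_inv
      simp only [map_mul, map_one, det_mul, det_one] at h ih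
      rwa [ih, one_mul] at h⟩
  map_one' := Subtype.ext (map_one φ.mapMatrix)
  map_mul' g h := Subtype.ext (map_mul φ.mapMatrix _ _)

lemma coe_reduction_elem {B : Type*} [CommRing B] (n : ℕ) (φ : Cl n →+* B) (x : Vn n) :
    (reduction n φ (elem n x) : Matrix (Fin 2) (Fin 2) B) = !![φ x, 1; -1, 0] := by
  change (!![(x : Cl n), 1; -1, 0]).map φ = _
  ext i j
  fin_cases i <;> fin_cases j <;> simp

/-- The sign character of `SL₂(𝔽₂) ≅ S₃`. -/
def signChar : SpecialLinearGroup (Fin 2) (ZMod 2) →* Multiplicative (ZMod 2) :=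
  MonoidHom.mk'
    (fun g => Multiplicative.ofAdd (g 0 0 * g 0 1 + g 0 1 * g 1 0 + g 1 0 * g 1 1))
    (fun g h => by
      have key : ∀ a b c d a' b' c' d' : ZMod 2, a * d - b * c = 1 → a' * d' - b' * c' = 1 →
          (a * a' + b * c') * (a * b' + b * d') + (a * b' + b * d') * (c * a' + d * c') +
            (c * a' + d * c') * (c * b' + d * d') =
          (a * b + b * c + c * d) + (a' * b' + b' * c' + c' * d') := by
        decide
      have hg := g.det_coe
      have hh := h.det_coe
      rw [det_fin_two] at hg hh
      rw [← ofAdd_add]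
      simpa [SpecialLinearGroup.coe_mul, mul_apply, Fin.sum_univ_two] using
        congrArg Multiplicative.ofAdd (key _ _ _ _ _ _ _ _ hg hh))

/-- The functional `X ↦ x₀₀ + x₀₁ + x₁₀`, which on trace-zero matrices over `𝔽₂` is invariant
under conjugation. -/
def conjFun (X : Matrix (Fin 2) (Fin 2) (ZMod 2)) : ZMod 2 :=
  X 0 0 + X 0 1 + X 1 0

lemma conjFun_conj (G X : Matrix (Fin 2) (Fin 2) (ZMod 2)) (hG : G.det = 1) (hX : X.trace = 0) :
    conjFun (G * X * G.adjugate) = conjFun X := by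
  have coeffs : ∀ a b c d : ZMod 2, a * d - b * c = 1 →
      a * d + b * c = 1 ∧ a * a - a * c - c * c = 1 ∧ b * d - b * b + d * d = 1 := by
    decide
  have two : (2 : ZMod 2) = 0 := rfl
  rw [det_fin_two] at hG
  rw [trace_fin_two] at hX
  obtain ⟨hx, hy, hz⟩ := coeffs _ _ _ _ hG
  simp only [conjFun, mul_apply, Fin.sum_univ_two, adjugate_fin_two, of_apply, cons_val',
    cons_val_zero, cons_val_one, cons_val_fin_one]
  linear_combination X 0 0 * hx + X 0 1 * hy + X 1 0 * hz +
    (G 0 0 * G 0 1 - G 0 1 * G 1 0 - G 1 0 * G 1 1) * hX +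
    (G 1 0 * G 1 1 - G 0 0 * G 0 1) * X 0 0 * two

lemma conjFun_mul (G G' H H' : Matrix (Fin 2) (Fin 2) (ZMod 2)) (hG : G.det = 1)
    (hH : H.det = 1) (hH' : (H' * H.adjugate).trace = 0) :
    conjFun ((G * H' + G' * H) * (G * H).adjugate) =
      conjFun (G' * G.adjugate) + conjFun (H' * H.adjugate) := by
  have cancel : G' * H * (H.adjugate * G.adjugate) = G' * G.adjugate := by
    rw [Matrix.mul_assoc, ← Matrix.mul_assoc H, mul_adjugate, hH, one_smul, Matrix.one_mul]
  have assoc : G * H' * (H.adjugate * G.adjugate) = G * (H' * H.adjugate) * G.adjugate := by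
    simp only [Matrix.mul_assoc]
  rw [adjugate_mul_distrib, Matrix.add_mul, cancel, assoc, ← conjFun_conj G _ hG hH']
  simp only [conjFun, Matrix.add_apply]
  ring

section DualNumber

variable (g h : SpecialLinearGroup (Fin 2) (DualNumber (ZMod 2)))

lemma det_map_fst : (g.1.map TrivSqZeroExt.fst).det = 1 := by
  have h0 := congrArg TrivSqZeroExt.fst g.det_coe
  rw [det_fin_two] at h0 ⊢
  simpa using h0

lemma trace_snd_mul_adjugate_fst :
    (g.1.map TrivSqZeroExt.snd * (g.1.map TrivSqZeroExt.fst).adjugate).trace = 0 := by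
  have h1 := congrArg TrivSqZeroExt.snd g.det_coe
  rw [det_fin_two] at h1
  simp only [TrivSqZeroExt.snd_sub, TrivSqZeroExt.snd_mul, TrivSqZeroExt.snd_one, smul_eq_mul,
    MulOpposite.smul_eq_mul_unop, MulOpposite.unop_op] at h1
  rw [trace_fin_two, adjugate_fin_two]
  simp only [mul_apply, Fin.sum_univ_two, map_apply, of_apply, cons_val', cons_val_zero,
    cons_val_one, cons_val_fin_one]
  linear_combination h1

lemma map_fst_mul : (g * h).1.map TrivSqZeroExt.fst =
    g.1.map TrivSqZeroExt.fst * h.1.map TrivSqZeroExt.fst := by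
  ext i j
  simp [mul_apply, Fin.sum_univ_two]

lemma map_snd_mul : (g * h).1.map TrivSqZeroExt.snd =
    g.1.map TrivSqZeroExt.fst * h.1.map TrivSqZeroExt.snd +
      g.1.map TrivSqZeroExt.snd * h.1.map TrivSqZeroExt.fst := by
  ext i j
  simp [mul_apply, Fin.sum_univ_two]
  ring

end DualNumber

/-- The character of `SL₂(𝔽₂[ε])` sending `M₀ + M₁ε` to the value of `conjFun` at `M₁M₀⁻¹`. -/
def derivChar : SpecialLinearGroup (Fin 2) (DualNumber (ZMod 2)) →* Multiplicative (ZMod 2) :=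
  MonoidHom.mk'
    (fun g => Multiplicative.ofAdd
      (conjFun (g.1.map TrivSqZeroExt.snd * (g.1.map TrivSqZeroExt.fst).adjugate)))
    (fun g h => by
      rw [map_fst_mul, map_snd_mul, conjFun_mul _ _ _ _ (det_map_fst g) (det_map_fst h)
        (trace_snd_mul_adjugate_fst h), ofAdd_add])

/-- The ring homomorphism `C_n(ℤ) → 𝔽₂[ε]` with `i_h ↦ 1 + c_h ε`. -/
def toDual (n : ℕ) (c : Fin (n - 1) → ZMod 2) : Cl n →ₐ[ℤ] DualNumber (ZMod 2) :=
  CliffordAlgebra.lift (Qf n) ⟨Fintype.linearCombination ℤ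
    (fun h => TrivSqZeroExt.inl 1 + TrivSqZeroExt.inr (c h)), fun m => by
      have hQ : (Qf n m : ZMod 2) = ∑ h, (m h : ZMod 2) * m h := by
        simp [Qf, QuadraticMap.weightedSumSquares_apply, CharTwo.neg_eq]
      ext
      · rw [TrivSqZeroExt.fst_mul, Fintype.linearCombination_apply, TrivSqZeroExt.fst_sum]
        simp [CharTwo.sum_mul_self, hQ]
      · simp [mul_comm, CharTwo.add_self_eq_zero]⟩

lemma toDual_iGen (n : ℕ) (c : Fin (n - 1) → ZMod 2) (h : Fin (n - 1)) :
    toDual n c (iGen n h) = TrivSqZeroExt.inl 1 + TrivSqZeroExt.inr (c h) := by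
  simp [toDual, iGen, Fintype.linearCombination_apply_single]

/-- The additive character of the abelianization induced by a character of `E₂(Γ_n(ℤ))`. -/
def abChar (n : ℕ) (χ : E2Gamma n →* Multiplicative (ZMod 2)) :
    Additive (Abelianization (E2Gamma n)) →+ ZMod 2 :=
  MonoidHom.toAdditiveLeft (Abelianization.lift χ)

lemma abChar_transv (n : ℕ) (χ : E2Gamma n →* Multiplicative (ZMod 2)) (x : Vn n) :
    abChar n χ (transv n x) = (χ (elem n x)).toAdd - (χ (elem n 0)).toAdd := by
  simp [abChar, transv]

lemma derivChar_elem (n : ℕ) (c : Fin (n - 1) → ZMod 2) (x : Vn n) :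
    derivChar (reduction n (toDual n c) (elem n x)) =
      Multiplicative.ofAdd (toDual n c x).snd := by
  simp [derivChar, conjFun, coe_reduction_elem, mul_apply, Fin.sum_univ_two, adjugate_fin_two]

lemma signChar_elem (n : ℕ) (φ : Cl n →+* ZMod 2) (x : Vn n) :
    signChar (reduction n φ (elem n x)) = Multiplicative.ofAdd (φ x + 1) := by
  simp [signChar, coe_reduction_elem]

end Characters

lemma linearIndependent_transvGen (n : ℕ)
    [Module (ZMod 2) (Additive (Abelianization (E2Gamma n)))] :
    LinearIndependent (ZMod 2) (transvGen n) := by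
  rw [Fintype.linearIndependent_iff]
  intro g hg
  have apply_char : ∀ χ, ∑ i, g i * abChar n χ (transvGen n i) = 0 := by
    intro χ
    have := congrArg ((abChar n χ).toZModLinearMap 2) hg
    simpa only [map_sum, map_smul, map_zero, smul_eq_mul, AddMonoidHom.coe_toZModLinearMap]
      using this
  have hsome : ∀ h, g (some h) = 0 := by
    intro h
    have := apply_char (derivChar.comp (reduction n (toDual n (Pi.single h 1))))
    simpa [Fintype.sum_option, transvGen, abChar_transv, derivChar_elem, toDual_iGen,
      Pi.single_apply, apply_ite TrivSqZeroExt.snd] using this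
  have hnone : g none = 0 := by
    have := apply_char (signChar.comp (reduction n
      ((TrivSqZeroExt.fstHom ℤ (ZMod 2) (ZMod 2)).comp (toDual n 0) : Cl n →+* ZMod 2)))
    simpa [Fintype.sum_option, transvGen, abChar_transv, signChar_elem, toDual_iGen, hsome]
      using this
  rintro (_ | h)
  exacts [hnone, hsome h]

/-- For `n ≥ 2`, the abelianization of `E₂(Γ_n(ℤ))` is elementary abelian of order `2ⁿ`,
i.e. isomorphic to the direct product of `n` copies of the cyclic group of order `2`. -/
theorem abelianization_E2Gamma (n : ℕ) (hn : 2 ≤ n) :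
    Nonempty (Abelianization ↥(E2Gamma n) ≃* (Fin n → Multiplicative (ZMod 2))) := by
  have h2 : ∀ y : Additive (Abelianization (E2Gamma n)), 2 • y = 0 := fun y => by
    obtain ⟨x, rfl⟩ := transv_surjective n hn y
    exact two_nsmul_transv n hn x
  let _ : Module (ZMod 2) (Additive (Abelianization (E2Gamma n))) := AddCommGroup.zmodModule h2
  let b := (Module.Basis.mk (linearIndependent_transvGen n) (span_transvGen n hn)).reindex
    (Fintype.equivFinOfCardEq (n := n) (by simp; omega))
  exact ⟨{
    toFun := fun x i => Multiplicative.ofAdd (b.equivFun (Additive.ofMul x) i)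
    invFun := fun f => Additive.toMul (b.equivFun.symm fun i => (f i).toAdd)
    left_inv := fun x => by simp
    right_inv := fun f => by
      funext i
      exact congrArg Multiplicative.ofAdd (congrFun (b.equivFun.apply_symm_apply _) i)
    map_mul' := fun x y => by funext i; simp }⟩
end
end
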